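/- Let n ≥ 3, N = 2n/(n-2), and Ω a smooth bounded open set of ℝⁿ. There exists δ = δ(Ω, n) > 0 such that for every ε > 0 and every solution u of Δu = u^{N-1-ε} in Ω with u > 0 in Ω and u = 0 on ∂Ω, any point x_ε ∈ Ω at which u attains its maximum over Ω satisfies dist(x_ε, ∂Ω) ≥ δ. -/

import Mathlib

open MeasureTheory Metric Set

/-- The geometric Laplacian `Δu = -∑ ∂²u/∂xᵢ²` on `ℝⁿ`. -/
noncomputable def lap {n : ℕ} (u : EuclideanSpace ℝ (Fin n) → ℝ)
    (x : EuclideanSpace ℝ (Fin n)) : ℝ :=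
  -∑ i : Fin n,
    iteratedFDeriv ℝ 2 u x ![EuclideanSpace.single i (1 : ℝ), EuclideanSpace.single i (1 : ℝ)]

/-- `Ω` has smooth (`C^∞`) boundary: near every boundary point, `Ω` is the sublevel
set of a smooth local defining function with nonvanishing differential. -/
def HasSmoothBoundary {n : ℕ} (Ω : Set (EuclideanSpace ℝ (Fin n))) : Prop :=
  ∀ x ∈ frontier Ω, ∃ (U : Set (EuclideanSpace ℝ (Fin n))) (f : EuclideanSpace ℝ (Fin n) → ℝ),
    IsOpen U ∧ x ∈ U ∧ ContDiff ℝ (⊤ : ℕ∞) f ∧ (∀ y ∈ U, fderiv ℝ f y ≠ 0) ∧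
    Ω ∩ U = {y | y ∈ U ∧ f y < 0}

/-- `u` is a solution of `Δu = u^p` in `Ω`, positive in `Ω`, vanishing on `∂Ω`,
of class `C²(Ω) ∩ C(closure Ω)`. -/
def IsSolution {n : ℕ} (Ω : Set (EuclideanSpace ℝ (Fin n)))
    (u : EuclideanSpace ℝ (Fin n) → ℝ) (p : ℝ) : Prop :=
  ContDiffOn ℝ 2 u Ω ∧ ContinuousOn u (closure Ω) ∧
  (∀ x ∈ Ω, lap u x = u x ^ p) ∧ (∀ x ∈ Ω, 0 < u x) ∧ (∀ x ∈ frontier Ω, u x = 0)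

open Filter Topology

section SecondDerivative

variable {n : ℕ}

local notation "E" => EuclideanSpace ℝ (Fin n)

theorem eventually_hasDerivAt_line {u : E → ℝ} {x : E} (hu : ContDiffAt ℝ 2 u x) (e : E) :
    ∀ᶠ t : ℝ in 𝓝 0, HasDerivAt (fun t : ℝ => u (x + t • e)) (fderiv ℝ u (x + t • e) e) t := by
  have h1 : ∀ᶠ z in 𝓝 x, ContDiffAt ℝ 2 u z := hu.eventually (by simp)
  have h2 : Tendsto (fun t : ℝ => x + t • e) (𝓝 0) (𝓝 x) := by
    have : Continuous (fun t : ℝ => x + t • e) := by fun_prop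
    simpa using this.tendsto 0
  filter_upwards [h2.eventually h1] with t ht
  have hd := (ht.differentiableAt (by norm_num)).hasFDerivAt
  have hl : HasDerivAt (fun t : ℝ => x + t • e) e t := by
    simpa using ((hasDerivAt_id t).smul_const e).const_add x
  exact hd.comp_hasDerivAt t hl

theorem hasDerivAt_fderiv_line {u : E → ℝ} {x : E} (hu : ContDiffAt ℝ 2 u x) (e : E) :
    HasDerivAt (fun t : ℝ => fderiv ℝ u (x + t • e) e) (iteratedFDeriv ℝ 2 u x ![e, e]) 0 := by
  have h1 : ContDiffAt ℝ 1 (fderiv ℝ u) x := hu.fderiv_right (by norm_num)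
  have hd := (h1.differentiableAt (by norm_num)).hasFDerivAt
  have hl : HasDerivAt (fun t : ℝ => x + t • e) e 0 := by
    simpa using ((hasDerivAt_id (0 : ℝ)).smul_const e).const_add x
  have hd' : HasFDerivAt (fderiv ℝ u) (fderiv ℝ (fderiv ℝ u) x) (x + (0 : ℝ) • e) := by
    simpa using hd
  have h2 : HasDerivAt (fun t : ℝ => fderiv ℝ u (x + t • e)) (fderiv ℝ (fderiv ℝ u) x e) 0 :=
    hd'.comp_hasDerivAt (0 : ℝ) hl
  refine (h2.clm_apply (hasDerivAt_const (0 : ℝ) e)).congr_deriv ?_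
  rw [iteratedFDeriv_two_apply]
  simp

theorem iteratedFDeriv_two_eq_of_line {u : E → ℝ} {x e : E} (hu : ContDiffAt ℝ 2 u x)
    {g : ℝ → ℝ} {c : ℝ}
    (hg : ∀ᶠ t : ℝ in 𝓝 0, HasDerivAt (fun t : ℝ => u (x + t • e)) (g t) t)
    (hc : HasDerivAt g c 0) : iteratedFDeriv ℝ 2 u x ![e, e] = c := by
  have h1 : (fun t : ℝ => fderiv ℝ u (x + t • e) e) =ᶠ[𝓝 0] g := by
    filter_upwards [hg, eventually_hasDerivAt_line hu e] with t h h'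
    exact h'.unique h
  exact (hasDerivAt_fderiv_line hu e).unique (hc.congr_of_eventuallyEq h1)

theorem nonneg_of_isLocalMin_of_hasDerivAt {f g : ℝ → ℝ} {c : ℝ}
    (hf : ∀ᶠ t : ℝ in 𝓝 0, HasDerivAt f (g t) t) (hg : HasDerivAt g c 0)
    (hmin : IsLocalMin f 0) : 0 ≤ c := by
  by_contra! hc
  have hfg : deriv f =ᶠ[𝓝 0] g := hf.mono fun t ht => ht.deriv
  have h2 : deriv (deriv f) 0 = c := by rw [hfg.deriv_eq, hg.deriv]
  have h0 : deriv f 0 = 0 := hmin.deriv_eq_zero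
  have hmax : IsLocalMax f 0 :=
    isLocalMax_of_deriv_deriv_neg (h2 ▸ hc) h0 hf.self_of_nhds.continuousAt
  have hconst : f =ᶠ[𝓝 0] fun _ => f 0 := by
    filter_upwards [hmax, hmin] with t h h' using le_antisymm h h'
  have h3 : deriv f =ᶠ[𝓝 0] fun _ => 0 := by
    have := hconst.deriv
    simpa using this
  have : deriv (deriv f) 0 = 0 := by rw [h3.deriv_eq]; simp
  linarith

theorem lap_nonpos_of_isLocalMin {u : E → ℝ} {x : E} (hu : ContDiffAt ℝ 2 u x)
    (hmin : IsLocalMin u x) : lap u x ≤ 0 := by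
  unfold lap
  rw [neg_nonpos]
  refine Finset.sum_nonneg fun i _ => ?_
  refine nonneg_of_isLocalMin_of_hasDerivAt (eventually_hasDerivAt_line hu _)
    (hasDerivAt_fderiv_line hu _) ?_
  have h2 : Tendsto (fun t : ℝ => x + t • EuclideanSpace.single i (1 : ℝ)) (𝓝 0) (𝓝 x) := by
    have : Continuous (fun t : ℝ => x + t • EuclideanSpace.single i (1 : ℝ)) := by fun_prop
    simpa using this.tendsto 0
  have := h2.eventually hmin
  unfold IsLocalMin IsMinFilter
  simpa using this

theorem lap_sub {u v : E → ℝ} {x : E} (hu : ContDiffAt ℝ 2 u x) (hv : ContDiffAt ℝ 2 v x) :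
    lap (fun z => u z - v z) x = lap u x - lap v x := by
  unfold lap
  rw [← neg_sub_neg, neg_neg, neg_neg, ← neg_sub, ← Finset.sum_sub_distrib]
  refine congrArg _ (Finset.sum_congr rfl fun i _ => ?_)
  refine iteratedFDeriv_two_eq_of_line (hu.sub hv) ?_
    ((hasDerivAt_fderiv_line hu _).sub (hasDerivAt_fderiv_line hv _))
  filter_upwards [eventually_hasDerivAt_line hu (EuclideanSpace.single i 1),
    eventually_hasDerivAt_line hv (EuclideanSpace.single i 1)] with t h h'
  exact h.sub h'

theorem lap_const_mul {u : E → ℝ} {x : E} (hu : ContDiffAt ℝ 2 u x) (c : ℝ) :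
    lap (fun z => c * u z) x = c * lap u x := by
  unfold lap
  rw [mul_neg, Finset.mul_sum]
  refine congrArg _ (Finset.sum_congr rfl fun i _ => ?_)
  refine iteratedFDeriv_two_eq_of_line (contDiffAt_const.mul hu) ?_
    ((hasDerivAt_fderiv_line hu _).const_mul c)
  filter_upwards [eventually_hasDerivAt_line hu (EuclideanSpace.single i 1)] with t h
  exact h.const_mul c

/-- Two functions, one touching the other from above, have ordered Laplacians. -/
theorem lap_le_of_touching {u v : E → ℝ} {x : E} (hu : ContDiffAt ℝ 2 u x)
    (hv : ContDiffAt ℝ 2 v x) (hmin : IsLocalMin (fun z => u z - v z) x) :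
    lap u x ≤ lap v x := by
  have := lap_nonpos_of_isLocalMin (hu.sub hv) hmin
  rw [lap_sub hu hv] at this
  linarith

/-- Chain rule for the Laplacian of a real function of a scalar function. -/
theorem lap_comp {u : E → ℝ} {x : E} (hu : ContDiffAt ℝ 2 u x) {G G' : ℝ → ℝ} {G'' : ℝ}
    (hGc : ContDiffAt ℝ 2 G (u x)) (hG : ∀ᶠ s in 𝓝 (u x), HasDerivAt G (G' s) s)
    (hG' : HasDerivAt G' G'' (u x)) :
    lap (fun z => G (u z)) x = G' (u x) * lap u x -
      G'' * ∑ i : Fin n, (fderiv ℝ u x (EuclideanSpace.single i 1)) ^ 2 := by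
  have key : ∀ i : Fin n, iteratedFDeriv ℝ 2 (fun z => G (u z)) x
      ![EuclideanSpace.single i (1 : ℝ), EuclideanSpace.single i (1 : ℝ)] =
      G' (u x) * iteratedFDeriv ℝ 2 u x
        ![EuclideanSpace.single i (1 : ℝ), EuclideanSpace.single i (1 : ℝ)] +
      G'' * (fderiv ℝ u x (EuclideanSpace.single i 1)) ^ 2 := by
    intro i
    set e : E := EuclideanSpace.single i (1 : ℝ)
    have h2 : Tendsto (fun t : ℝ => u (x + t • e)) (𝓝 0) (𝓝 (u x)) := by
      have h : Continuous (fun t : ℝ => x + t • e) := by fun_prop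
      have h' : ContinuousAt u (x + (0 : ℝ) • e) := by simpa using hu.continuousAt
      have := ContinuousAt.comp (f := fun t : ℝ => x + t • e) h' h.continuousAt
      simpa [ContinuousAt, Function.comp_def] using this
    have hl := eventually_hasDerivAt_line hu e
    have hl0 := hl.self_of_nhds
    refine iteratedFDeriv_two_eq_of_line
      (g := fun t => G' (u (x + t • e)) * fderiv ℝ u (x + t • e) e)
      (hGc.comp x hu) ?_ ?_
    · filter_upwards [hl, h2.eventually hG] with t h h'
      exact h'.comp t h
    · have hG0 : HasDerivAt G' G'' (u (x + (0 : ℝ) • e)) := by simpa using hG'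
      have := (hG0.comp (0 : ℝ) hl0).mul (hasDerivAt_fderiv_line hu e)
      refine this.congr_deriv ?_
      simp only [zero_smul, add_zero, Function.comp_apply]
      ring
  unfold lap
  rw [Finset.sum_congr rfl fun i _ => key i, Finset.sum_add_distrib, ← Finset.mul_sum,
    ← Finset.mul_sum]
  ring

theorem lap_norm_sq_sub (y x : E) : lap (fun z => ‖z - y‖ ^ 2) x = -(2 * n) := by
  have hc : ContDiffAt ℝ 2 (fun z : E => ‖z - y‖ ^ 2) x :=
    ((contDiff_id.sub contDiff_const).norm_sq ℝ).contDiffAt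
  have key : ∀ i : Fin n, iteratedFDeriv ℝ 2 (fun z : E => ‖z - y‖ ^ 2) x
      ![EuclideanSpace.single i (1 : ℝ), EuclideanSpace.single i (1 : ℝ)] = 2 := by
    intro i
    set e : E := EuclideanSpace.single i (1 : ℝ)
    have he : ‖e‖ = 1 := by simp [e]
    refine iteratedFDeriv_two_eq_of_line (g := fun t => 2 * (inner ℝ (x - y) e + t)) hc ?_ ?_
    · refine Eventually.of_forall fun t => ?_
      have h1 : (fun t : ℝ => ‖x + t • e - y‖ ^ 2) =
          fun t => ‖x - y‖ ^ 2 + 2 * (t * inner ℝ (x - y) e) + t ^ 2 := by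
        funext t
        rw [add_sub_right_comm, norm_add_sq_real, inner_smul_right, norm_smul, he]
        simp
      rw [h1]
      have h2 := (((hasDerivAt_id t).mul_const (inner ℝ (x - y) e)).const_mul 2).const_add
        (‖x - y‖ ^ 2)
      have := h2.add (hasDerivAt_pow 2 t)
      refine this.congr_deriv ?_
      simp only [one_mul, Nat.cast_ofNat, Nat.add_one_sub_one, pow_one]
      ring
    · simpa using ((hasDerivAt_id (0 : ℝ)).const_add (inner ℝ (x - y) e)).const_mul 2
  unfold lap
  rw [Finset.sum_congr rfl fun i _ => key i]
  simp [mul_comm]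

theorem sum_fderiv_norm_sq_sub (y x : E) :
    ∑ i : Fin n, (fderiv ℝ (fun z : E => ‖z - y‖ ^ 2) x (EuclideanSpace.single i 1)) ^ 2 =
      4 * ‖x - y‖ ^ 2 := by
  have h : HasFDerivAt (fun z : E => ‖z - y‖ ^ 2) (2 • (innerSL ℝ (x - y))) x := by
    simpa using ((hasFDerivAt_id x).sub_const y).norm_sq
  rw [h.fderiv, EuclideanSpace.norm_sq_eq, Finset.mul_sum]
  refine Finset.sum_congr rfl fun i _ => ?_
  simp [EuclideanSpace.inner_single_right]
  ring

/-- The Laplacian of a radial function, written as a function of the squared radius. -/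
theorem lap_radial (y x : E) {G G' : ℝ → ℝ} {G'' : ℝ}
    (hGc : ContDiffAt ℝ 2 G (‖x - y‖ ^ 2))
    (hG : ∀ᶠ s in 𝓝 (‖x - y‖ ^ 2), HasDerivAt G (G' s) s)
    (hG' : HasDerivAt G' G'' (‖x - y‖ ^ 2)) :
    lap (fun z => G (‖z - y‖ ^ 2)) x =
      -(2 * n * G' (‖x - y‖ ^ 2) + 4 * ‖x - y‖ ^ 2 * G'') := by
  have hc : ContDiffAt ℝ 2 (fun z : E => ‖z - y‖ ^ 2) x :=
    ((contDiff_id.sub contDiff_const).norm_sq ℝ).contDiffAt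
  rw [lap_comp (u := fun z => ‖z - y‖ ^ 2) hc hGc hG hG', lap_norm_sq_sub,
    sum_fderiv_norm_sq_sub]
  ring

end SecondDerivative

section Kelvin

variable {n : ℕ}

local notation "E" => EuclideanSpace ℝ (Fin n)

/-- Second derivative along a line of a product `ρ * (u ∘ φ)`. -/
theorem iteratedFDeriv_two_mul_comp {u w : E → ℝ} {x z e : E} (hw : ContDiffAt ℝ 2 w x)
    (hu : ContDiffAt ℝ 2 u z) {ρ ρ₁ : ℝ → ℝ} {ρ₂ : ℝ} {φ φ₁ : ℝ → E} {φ₂ : E}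
    (hwl : ∀ t : ℝ, w (x + t • e) = ρ t * u (φ t)) (hz : φ 0 = z)
    (hρ : ∀ᶠ t in 𝓝 0, HasDerivAt ρ (ρ₁ t) t) (hρ₁ : HasDerivAt ρ₁ ρ₂ 0)
    (hφ : ∀ᶠ t in 𝓝 0, HasDerivAt φ (φ₁ t) t) (hφ₁ : HasDerivAt φ₁ φ₂ 0) :
    iteratedFDeriv ℝ 2 w x ![e, e] = ρ₂ * u z + 2 * ρ₁ 0 * fderiv ℝ u z (φ₁ 0) +
      ρ 0 * (fderiv ℝ (fderiv ℝ u) z (φ₁ 0) (φ₁ 0) + fderiv ℝ u z φ₂) := by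
  have hφ0 := hφ.self_of_nhds
  have hρ0 := hρ.self_of_nhds
  have hcont : Tendsto φ (𝓝 0) (𝓝 z) := hz ▸ hφ0.continuousAt
  have hu' : ∀ᶠ z' in 𝓝 z, HasFDerivAt u (fderiv ℝ u z') z' := by
    filter_upwards [hu.eventually (by simp)] with z' h
    exact (h.differentiableAt (by norm_num)).hasFDerivAt
  have hfirst : ∀ᶠ t in 𝓝 (0 : ℝ), HasDerivAt (fun t => u (φ t)) (fderiv ℝ u (φ t) (φ₁ t)) t := by
    filter_upwards [hφ, hcont.eventually hu'] with t h h'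
    exact h'.comp_hasDerivAt t h
  have h1 : ContDiffAt ℝ 1 (fderiv ℝ u) z := hu.fderiv_right (by norm_num)
  have hd : HasFDerivAt (fderiv ℝ u) (fderiv ℝ (fderiv ℝ u) z) (φ 0) := by
    rw [hz]; exact (h1.differentiableAt (by norm_num)).hasFDerivAt
  have h2 : HasDerivAt (fun t : ℝ => fderiv ℝ u (φ t)) (fderiv ℝ (fderiv ℝ u) z (φ₁ 0)) 0 :=
    hd.comp_hasDerivAt (0 : ℝ) hφ0
  refine iteratedFDeriv_two_eq_of_line
    (g := fun t => ρ₁ t * u (φ t) + ρ t * fderiv ℝ u (φ t) (φ₁ t)) hw ?_ ?_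
  · simp only [hwl]
    filter_upwards [hρ, hfirst] with t h h'
    exact h.mul h'
  · refine ((hρ₁.mul hfirst.self_of_nhds).add (hρ0.mul (h2.clm_apply hφ₁))).congr_deriv ?_
    rw [hz]
    ring

theorem sum_coord_mul_apply (L : E →L[ℝ] ℝ) (X : E) :
    ∑ i : Fin n, X i * L (EuclideanSpace.single i 1) = L X := by
  conv_rhs => rw [← (EuclideanSpace.basisFun (Fin n) ℝ).sum_repr X]
  simp

theorem lap_kelvin {u : E → ℝ} {x y : E} (hxy : x ≠ y) (l : ℝ)
    (hu : ContDiffAt ℝ 2 u (y + (l / ‖x - y‖ ^ 2) • (x - y))) :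
    ContDiffAt ℝ 2 (fun x' => (‖x' - y‖ ^ 2) ^ (-((n : ℝ) - 2) / 2) *
      u (y + (l / ‖x' - y‖ ^ 2) • (x' - y))) x ∧
    lap (fun x' => (‖x' - y‖ ^ 2) ^ (-((n : ℝ) - 2) / 2) *
      u (y + (l / ‖x' - y‖ ^ 2) • (x' - y))) x =
      (‖x - y‖ ^ 2) ^ (-((n : ℝ) - 2) / 2) * (l ^ 2 / (‖x - y‖ ^ 2) ^ 2) *
        lap u (y + (l / ‖x - y‖ ^ 2) • (x - y)) := by
  set w : E → ℝ := fun x' => (‖x' - y‖ ^ 2) ^ (-((n : ℝ) - 2) / 2) *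
      u (y + (l / ‖x' - y‖ ^ 2) • (x' - y)) with hwdef
  set α : ℝ := -((n : ℝ) - 2) / 2 with hα
  set z : E := y + (l / ‖x - y‖ ^ 2) • (x - y) with hz
  set X : E := x - y with hX
  have hX0 : X ≠ 0 := sub_ne_zero.2 hxy
  set N : ℝ := ‖X‖ ^ 2 with hN
  have hNpos : 0 < N := by positivity
  have hsub : ContDiffAt ℝ 2 (fun x' : E => x' - y) x := contDiffAt_id.sub contDiffAt_const
  have hNc : ContDiffAt ℝ 2 (fun x' : E => ‖x' - y‖ ^ 2) x := hsub.norm_sq ℝ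
  have hw : ContDiffAt ℝ 2 w x := by
    refine (hNc.rpow_const_of_ne hNpos.ne').mul ?_
    refine ContDiffAt.comp x hu ?_
    exact contDiffAt_const.add ((contDiffAt_const.div hNc hNpos.ne').smul hsub)
  refine ⟨hw, ?_⟩
  set D := fderiv ℝ u z
  set B := fderiv ℝ (fderiv ℝ u) z
  set P := N ^ α with hP
  have hP1 : N ^ (α - 1) = P / N := by rw [Real.rpow_sub_one hNpos.ne']
  have hP2 : N ^ (α - 1 - 1) = P / N ^ 2 := by
    rw [Real.rpow_sub_one hNpos.ne', hP1]; field_simp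
  have key : ∀ i : Fin n, iteratedFDeriv ℝ 2 w x
      ![EuclideanSpace.single i (1 : ℝ), EuclideanSpace.single i (1 : ℝ)] =
      (4 * α * (α - 1) * (P / N ^ 2) * X i ^ 2 + 2 * α * (P / N)) * u z +
      2 * (2 * α * (P / N) * X i) *
        (-(2 * l * X i / N ^ 2) * D X + l / N * D (EuclideanSpace.single i 1)) +
      P * (((2 * l * X i / N ^ 2) ^ 2 * B X X
        - 2 * l * X i / N ^ 2 * (l / N) *
          (B X (EuclideanSpace.single i 1) + B (EuclideanSpace.single i 1) X) +
          (l / N) ^ 2 * B (EuclideanSpace.single i 1) (EuclideanSpace.single i 1)) +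
        ((-(2 * l / N ^ 2) + 8 * l * X i ^ 2 / N ^ 3) * D X +
          2 * (-(2 * l * X i / N ^ 2)) * D (EuclideanSpace.single i 1))) := by
    intro i
    set e : E := EuclideanSpace.single i (1 : ℝ) with he'
    have he : ‖e‖ = 1 := by simp [e]
    have hb : inner ℝ X e = X i := by simp [e, EuclideanSpace.inner_single_right]
    have hq : ∀ t : ℝ, ‖X + t • e‖ ^ 2 = N + 2 * X i * t + t ^ 2 := by
      intro t
      rw [norm_add_sq_real, inner_smul_right, norm_smul, he, hb]
      simp
      ring
    have hxt : ∀ t : ℝ, x + t • e - y = X + t • e := fun t => by rw [hX]; abel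
    set q : ℝ → ℝ := fun t => N + 2 * X i * t + t ^ 2 with hqdef
    set q₁ : ℝ → ℝ := fun t => 2 * X i + 2 * t with hq₁def
    have hq0 : q 0 = N := by simp [q]
    have hq₁0 : q₁ 0 = 2 * X i := by simp [q₁]
    have hqd : ∀ t, HasDerivAt q (q₁ t) t := by
      intro t
      have := (((hasDerivAt_id t).const_mul (2 * X i)).const_add N).add (hasDerivAt_pow 2 t)
      refine this.congr_deriv ?_
      simp [q₁]
    have hq₁d : HasDerivAt q₁ 2 0 := by
      refine (((hasDerivAt_id (0 : ℝ)).const_mul 2).const_add (2 * X i)).congr_deriv ?_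
      simp
    have hqpos : ∀ᶠ t in 𝓝 (0 : ℝ), 0 < q t :=
      (hqd 0).continuousAt.eventually (lt_mem_nhds (by rw [hq0]; exact hNpos))
    have hqp : ∀ β : ℝ, ∀ᶠ t in 𝓝 (0 : ℝ),
        HasDerivAt (fun t => q t ^ β) (q₁ t * β * q t ^ (β - 1)) t := fun β => by
      filter_upwards [hqpos] with t ht
      exact (hqd t).rpow_const (Or.inl ht.ne')
    have hlin : ∀ t : ℝ, HasDerivAt (fun t : ℝ => X + t • e) e t := fun t => by
      simpa using ((hasDerivAt_id t).smul_const e).const_add X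
    have hh : ∀ᶠ t in 𝓝 (0 : ℝ), HasDerivAt (fun t => l / q t) (-(l * q₁ t) / q t ^ 2) t := by
      filter_upwards [hqpos] with t ht
      have := (hasDerivAt_const t l).div (hqd t) ht.ne'
      refine this.congr_deriv ?_
      simp
    have hh1 : HasDerivAt (fun t => -(l * q₁ t) / q t ^ 2)
        (-(2 * l / N ^ 2) + 8 * l * X i ^ 2 / N ^ 3) 0 := by
      have := (hq₁d.const_mul l).neg.div ((hqd 0).pow 2) (by rw [Pi.pow_apply, hq0]; positivity)
      refine this.congr_deriv ?_
      simp only [Pi.pow_apply, Pi.neg_apply, hq0, hq₁0]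
      field_simp
      push_cast
      ring
    have hρ₁ : HasDerivAt (fun t => q₁ t * α * q t ^ (α - 1))
        (4 * α * (α - 1) * (P / N ^ 2) * X i ^ 2 + 2 * α * (P / N)) 0 := by
      refine ((hq₁d.mul_const α).mul (hqp (α - 1)).self_of_nhds).congr_deriv ?_
      rw [hq0, hq₁0, hP1, hP2]
      ring
    have hφ : ∀ᶠ t in 𝓝 (0 : ℝ), HasDerivAt (fun t => y + (l / q t) • (X + t • e))
        ((l / q t) • e + (-(l * q₁ t) / q t ^ 2) • (X + t • e)) t := by
      filter_upwards [hh] with t ht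
      exact (ht.smul (hlin t)).const_add y
    have hφ₁ : HasDerivAt (fun t => (l / q t) • e + (-(l * q₁ t) / q t ^ 2) • (X + t • e))
        ((-(2 * l / N ^ 2) + 8 * l * X i ^ 2 / N ^ 3) • X + (2 * (-(2 * l * X i / N ^ 2))) • e)
        0 := by
      refine ((hh.self_of_nhds.smul_const e).add (hh1.smul (hlin 0))).congr_deriv ?_
      simp only [hq0, hq₁0, zero_smul, add_zero]
      rw [← add_assoc, ← add_smul, add_comm]
      congr 2
      ring
    have := iteratedFDeriv_two_mul_comp (e := e) hw hu (fun t => ?_) ?_ (hqp α) hρ₁ hφ hφ₁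
    · rw [this]
      simp only [hq0, hq₁0, hP1, zero_smul, add_zero, map_add, map_smul, smul_eq_mul,
        _root_.add_apply, _root_.smul_apply]
      change _ + 2 * _ * (_ * D e + _ * D X) + P * (_ + _) = _
      ring
    · simp only [hwdef, hxt, hq, q]
    · simp [hq0, hz]
  have hS1 : ∑ i : Fin n, X i ^ 2 = N := by rw [hN, EuclideanSpace.real_norm_sq_eq]
  have hSD : ∑ i : Fin n, X i * D (EuclideanSpace.single i 1) = D X := sum_coord_mul_apply D X
  have hSB1 : ∑ i : Fin n, X i * B X (EuclideanSpace.single i 1) = B X X :=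
    sum_coord_mul_apply (B X) X
  have hSB2 : ∑ i : Fin n, X i * B (EuclideanSpace.single i 1) X = B X X :=
    sum_coord_mul_apply (B.flip X) X
  have hlapu : lap u z = -∑ i : Fin n, B (EuclideanSpace.single i 1) (EuclideanSpace.single i 1) := by
    simp [lap, iteratedFDeriv_two_apply, B]
  have hn : (n : ℝ) = 2 - 2 * α := by rw [hα]; ring
  have htotal : ∑ i : Fin n, iteratedFDeriv ℝ 2 w x
      ![EuclideanSpace.single i (1 : ℝ), EuclideanSpace.single i (1 : ℝ)] =
      (4 * α * (α - 1) * (P / N ^ 2) * ∑ i : Fin n, X i ^ 2 + n * (2 * α * (P / N))) * u z +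
      (-(8 * α * P * l / N ^ 3) * D X * ∑ i : Fin n, X i ^ 2 +
        4 * α * P * l / N ^ 2 * ∑ i : Fin n, X i * D (EuclideanSpace.single i 1)) +
      P * (((2 * l / N ^ 2) ^ 2 * B X X * ∑ i : Fin n, X i ^ 2
        - 2 * l / N ^ 2 * (l / N) * (∑ i : Fin n, X i * B X (EuclideanSpace.single i 1)
          + ∑ i : Fin n, X i * B (EuclideanSpace.single i 1) X) +
          (l / N) ^ 2 * ∑ i : Fin n,
            B (EuclideanSpace.single i 1) (EuclideanSpace.single i 1)) +
        ((n * (-(2 * l / N ^ 2)) + 8 * l / N ^ 3 * ∑ i : Fin n, X i ^ 2) * D X +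
          2 * (-(2 * l / N ^ 2)) * ∑ i : Fin n, X i * D (EuclideanSpace.single i 1))) := by
    have hc : ∀ c : ℝ, (n : ℝ) * c = ∑ _i : Fin n, c := fun c => by simp
    rw [Finset.sum_congr rfl fun i _ => key i, hc, hc]
    simp only [Finset.mul_sum, ← Finset.sum_add_distrib, ← Finset.sum_sub_distrib,
      Finset.sum_mul]
    refine Finset.sum_congr rfl fun i _ => ?_
    field_simp
    ring
  rw [hlapu]
  unfold lap
  rw [htotal, hS1, hSD, hSB1, hSB2, hn]
  field_simp
  ring

end Kelvin

section MovingSpheres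

variable {n : ℕ}

local notation "E" => EuclideanSpace ℝ (Fin n)

/-- The Kelvin transform of `u` in the sphere with centre `y` and squared radius `l`. -/
noncomputable def kelvin (u : E → ℝ) (y : E) (l : ℝ) (x : E) : ℝ :=
  (l / ‖x - y‖ ^ 2) ^ (((n : ℝ) - 2) / 2) * u (y + (l / ‖x - y‖ ^ 2) • (x - y))

theorem contDiffAt_kelvin_and_lap {u : E → ℝ} {x y : E} (hxy : x ≠ y) {l : ℝ} (hl : 0 < l)
    (hu : ContDiffAt ℝ 2 u (y + (l / ‖x - y‖ ^ 2) • (x - y))) :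
    ContDiffAt ℝ 2 (kelvin u y l) x ∧ lap (kelvin u y l) x =
      (l / ‖x - y‖ ^ 2) ^ (((n : ℝ) - 2) / 2 + 2) *
        lap u (y + (l / ‖x - y‖ ^ 2) • (x - y)) := by
  have hN : 0 < ‖x - y‖ ^ 2 := by
    have := norm_pos_iff.2 (sub_ne_zero.2 hxy)
    positivity
  have heq : kelvin u y l = fun x' => l ^ (((n : ℝ) - 2) / 2) *
      ((‖x' - y‖ ^ 2) ^ (-((n : ℝ) - 2) / 2) * u (y + (l / ‖x' - y‖ ^ 2) • (x' - y))) := by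
    funext x'
    rw [kelvin, Real.div_rpow hl.le (by positivity), neg_div, Real.rpow_neg (by positivity)]
    ring
  obtain ⟨h1, h2⟩ := lap_kelvin hxy l hu
  rw [heq]
  refine ⟨contDiffAt_const.mul h1, ?_⟩
  rw [lap_const_mul h1, h2, Real.rpow_add (by positivity), Real.div_rpow hl.le (by positivity),
    neg_div, Real.rpow_neg (by positivity), Real.rpow_two]
  field_simp

theorem rpow_sub_rpow_le {p a b M : ℝ} (hp : 1 ≤ p) (ha : 0 < a) (hab : a ≤ b) (hb : b ≤ M) :
    b ^ p - a ^ p ≤ p * M ^ (p - 1) * (b - a) := by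
  have hb0 : 0 < b := ha.trans_le hab
  have h1 := one_add_mul_self_le_rpow_one_add (s := a / b - 1)
    (by have : 0 < a / b := by positivity
        linarith) hp
  rw [add_sub_cancel, Real.div_rpow ha.le hb0.le, le_div_iff₀ (by positivity)] at h1
  have h2 : b ^ p = b ^ (p - 1) * b := by
    rw [← Real.rpow_add_one hb0.ne']; ring_nf
  have h3 : b ^ (p - 1) ≤ M ^ (p - 1) := Real.rpow_le_rpow hb0.le hb (by linarith)
  have h4 : b ^ p - a ^ p ≤ p * b ^ (p - 1) * (b - a) := by
    have : (1 + p * (a / b - 1)) * b ^ p = b ^ p - p * b ^ (p - 1) * (b - a) := by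
      rw [h2]; field_simp; ring
    linarith
  refine h4.trans ?_
  have : 0 ≤ b - a := by linarith
  gcongr

/-- The conditions under which spheres centred at `y`, of squared radius at most `l₁`, can be
moved into `Ω`. -/
structure IsMovingSphereSetup (Ω : Set (EuclideanSpace ℝ (Fin n)))
    (u : EuclideanSpace ℝ (Fin n) → ℝ) (p M : ℝ) (y : EuclideanSpace ℝ (Fin n)) (d l₁ : ℝ) :
    Prop where
  isOpen : IsOpen Ω
  isBounded : Bornology.IsBounded Ω
  isSolution : IsSolution Ω u p
  one_le : 1 ≤ p
  subcritical : ((n : ℝ) - 2) / 2 * p < ((n : ℝ) - 2) / 2 + 2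
  le_bound : ∀ x ∈ Ω, u x ≤ M
  d_pos : 0 < d
  d_le : ∀ x ∈ closure Ω, d ≤ ‖x - y‖ ^ 2
  reflect_mem : ∀ x ∈ closure Ω, ∀ s : ℝ, 1 < s → s * ‖x - y‖ ^ 2 ≤ l₁ → y + s • (x - y) ∈ Ω

theorem IsSolution.contDiffAt {Ω : Set E} {u : E → ℝ} {p : ℝ} (hΩ : IsOpen Ω)
    (h : IsSolution Ω u p) {x : E} (hx : x ∈ Ω) : ContDiffAt ℝ 2 u x :=
  h.1.contDiffAt (hΩ.mem_nhds hx)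

namespace IsMovingSphereSetup

variable {Ω : Set (EuclideanSpace ℝ (Fin n))} {u : EuclideanSpace ℝ (Fin n) → ℝ} {p M : ℝ}
  {y : EuclideanSpace ℝ (Fin n)} {d l₁ : ℝ}

theorem sq_pos (h : IsMovingSphereSetup Ω u p M y d l₁) {x : E} (hx : x ∈ closure Ω) :
    0 < ‖x - y‖ ^ 2 := h.d_pos.trans_le (h.d_le x hx)

theorem ne_center (h : IsMovingSphereSetup Ω u p M y d l₁) {x : E} (hx : x ∈ closure Ω) :
    x ≠ y := by
  rintro rfl
  have := h.sq_pos hx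
  simp at this

theorem image_mem (h : IsMovingSphereSetup Ω u p M y d l₁) {x : E} (hx : x ∈ closure Ω) {l : ℝ}
    (hxl : ‖x - y‖ ^ 2 < l) (hl : l ≤ l₁) : y + (l / ‖x - y‖ ^ 2) • (x - y) ∈ Ω := by
  have hN := h.sq_pos hx
  refine h.reflect_mem x hx _ (by rwa [one_lt_div hN]) ?_
  rwa [div_mul_cancel₀ _ hN.ne']

theorem kelvin_eq_self (h : IsMovingSphereSetup Ω u p M y d l₁) {x : E} (hx : x ∈ closure Ω) :
    kelvin u y (‖x - y‖ ^ 2) x = u x := by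
  have hN := h.sq_pos hx
  rw [kelvin, div_self hN.ne']
  simp

theorem kelvin_pos (h : IsMovingSphereSetup Ω u p M y d l₁) {x : E} (hx : x ∈ closure Ω) {l : ℝ}
    (hxl : ‖x - y‖ ^ 2 < l) (hl : l ≤ l₁) : 0 < kelvin u y l x := by
  have hN := h.sq_pos hx
  have hl0 : 0 < l := hN.trans hxl
  have := h.isSolution.2.2.2.1 _ (h.image_mem hx hxl hl)
  unfold kelvin
  positivity

theorem contDiffAt_kelvin (h : IsMovingSphereSetup Ω u p M y d l₁) {x : E} (hx : x ∈ closure Ω)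
    {l : ℝ} (hxl : ‖x - y‖ ^ 2 < l) (hl : l ≤ l₁) : ContDiffAt ℝ 2 (kelvin u y l) x :=
  (contDiffAt_kelvin_and_lap (h.ne_center hx) ((h.sq_pos hx).trans hxl)
    (h.isSolution.contDiffAt h.isOpen (h.image_mem hx hxl hl))).1

/-- The Kelvin transform is a strict supersolution inside the sphere. -/
theorem rpow_lt_lap_kelvin (h : IsMovingSphereSetup Ω u p M y d l₁) {x : E} (hx : x ∈ closure Ω)
    {l : ℝ} (hxl : ‖x - y‖ ^ 2 < l) (hl : l ≤ l₁) :
    kelvin u y l x ^ p < lap (kelvin u y l) x := by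
  have hN := h.sq_pos hx
  have hl0 : 0 < l := hN.trans hxl
  have hm := h.image_mem hx hxl hl
  have hU := h.isSolution.2.2.2.1 _ hm
  rw [(contDiffAt_kelvin_and_lap (h.ne_center hx) hl0 (h.isSolution.contDiffAt h.isOpen hm)).2,
    h.isSolution.2.2.1 _ hm, kelvin, Real.mul_rpow (by positivity) hU.le,
    ← Real.rpow_mul (by positivity)]
  have hU' := Real.rpow_pos_of_pos hU p
  exact mul_lt_mul_of_pos_right
    (Real.rpow_lt_rpow_of_exponent_lt ((one_lt_div hN).2 hxl) h.subcritical) hU'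

theorem continuousOn_kelvin (h : IsMovingSphereSetup Ω u p M y d l₁) :
    ContinuousOn (fun q : ℝ × E => kelvin u y q.1 q.2)
      {q | q.1 ≤ l₁ ∧ q.2 ∈ closure Ω ∧ ‖q.2 - y‖ ^ 2 ≤ q.1} := by
  set S : Set (ℝ × E) := {q | q.1 ≤ l₁ ∧ q.2 ∈ closure Ω ∧ ‖q.2 - y‖ ^ 2 ≤ q.1}
  have hN : ContinuousOn (fun q : ℝ × E => ‖q.2 - y‖ ^ 2) S := by fun_prop
  have hN0 : ∀ q ∈ S, ‖q.2 - y‖ ^ 2 ≠ 0 := fun q hq => (h.sq_pos hq.2.1).ne'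
  have hκ : ContinuousOn (fun q : ℝ × E => q.1 / ‖q.2 - y‖ ^ 2) S :=
    continuousOn_fst.div hN hN0
  have hκ0 : ∀ q ∈ S, q.1 / ‖q.2 - y‖ ^ 2 ≠ 0 := fun q hq => by
    have h1 := h.sq_pos hq.2.1
    have h2 : 0 < q.1 := h1.trans_le hq.2.2
    positivity
  refine (hκ.rpow_const fun q hq => Or.inl (hκ0 q hq)).mul ?_
  refine h.isSolution.2.1.comp (continuousOn_const.add (hκ.smul (by fun_prop))) ?_
  intro q hq
  rcases hq.2.2.lt_or_eq with hlt | heq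
  · exact subset_closure (h.image_mem hq.2.1 hlt hq.1)
  · simp only
    rw [heq, div_self (heq ▸ hN0 q hq)]
    simpa using hq.2.1

theorem continuousOn_kelvin_slice (h : IsMovingSphereSetup Ω u p M y d l₁) {l : ℝ}
    (hl : l ≤ l₁) :
    ContinuousOn (kelvin u y l) {x | x ∈ closure Ω ∧ ‖x - y‖ ^ 2 ≤ l} :=
  h.continuousOn_kelvin.comp (f := fun x : E => (l, x)) (by fun_prop)
    fun _ hx => ⟨hl, hx.1, hx.2⟩

/-- Positivity propagates to the boundary of the cap, by the strong maximum principle. -/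
theorem lt_kelvin_of_le (h : IsMovingSphereSetup Ω u p M y d l₁) {l : ℝ} (hl : l ≤ l₁)
    (hle : ∀ x ∈ Ω, ‖x - y‖ ^ 2 < l → u x ≤ kelvin u y l x) {x : E} (hx : x ∈ closure Ω)
    (hxl : ‖x - y‖ ^ 2 < l) : u x < kelvin u y l x := by
  by_cases hxΩ : x ∈ Ω
  · refine (hle x hxΩ hxl).lt_of_ne fun heq => ?_
    have hux := h.isSolution.contDiffAt h.isOpen hxΩ
    have hmin : IsLocalMin (fun z => kelvin u y l z - u z) x := by
      have h1 : ∀ᶠ z in 𝓝 x, ‖z - y‖ ^ 2 < l := by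
        have hc : Continuous fun z : E => ‖z - y‖ ^ 2 := by fun_prop
        exact hc.continuousAt.eventually (gt_mem_nhds hxl)
      filter_upwards [h1, h.isOpen.mem_nhds hxΩ] with z hz hzΩ
      have := hle z hzΩ hz
      linarith
    have h1 := lap_le_of_touching (h.contDiffAt_kelvin hx hxl hl) hux hmin
    have h2 := h.rpow_lt_lap_kelvin hx hxl hl
    rw [h.isSolution.2.2.1 x hxΩ, heq] at h1
    linarith
  · have : u x = 0 := h.isSolution.2.2.2.2 x ⟨hx, by rwa [h.isOpen.interior_eq]⟩
    rw [this]
    exact h.kelvin_pos hx hxl hl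

/-- The comparison holds in a thin shell near the sphere, provided it holds below the shell. -/
theorem exists_shell (h : IsMovingSphereSetup Ω u p M y d l₁) : ∃ η : ℝ, 0 < η ∧
    ∀ l, d ≤ l → l ≤ l₁ →
      (∀ x ∈ closure Ω, ‖x - y‖ ^ 2 ≤ l - η → u x ≤ kelvin u y l x) →
      ∀ x ∈ Ω, ‖x - y‖ ^ 2 < l → u x ≤ kelvin u y l x := by
  rcases Ω.eq_empty_or_nonempty with hemp | ⟨x₀, hx₀⟩
  · exact ⟨1, one_pos, by simp [hemp]⟩
  have hM : 0 < M := (h.isSolution.2.2.2.1 x₀ hx₀).trans_le (h.le_bound x₀ hx₀)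
  set C : ℝ := p * M ^ (p - 1) with hC
  have hC0 : 0 ≤ C := by
    have := h.one_le
    positivity
  have hd := h.d_pos
  set η : ℝ := d / (2 + n + C + d) with hη
  have hη0 : 0 < η := by positivity
  have hη1 : η < 1 := by
    rw [hη, div_lt_one (by positivity)]
    linarith [(Nat.cast_nonneg n : (0:ℝ) ≤ n)]
  have hηd : (2 + n + C) * η < d := by
    have : (2 + n + C + d) * η = d := by rw [hη]; field_simp
    nlinarith
  refine ⟨η, hη0, fun l hdl hl hbelow x₁ hx₁ hx₁l => ?_⟩
  by_contra! hneg
  set g : E → ℝ := fun z => 2 * η ^ 2 - (‖z - y‖ ^ 2 - l) ^ 2 with hg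
  set K : Set E := {x | x ∈ closure Ω ∧ l - η ≤ ‖x - y‖ ^ 2 ∧ ‖x - y‖ ^ 2 ≤ l} with hK
  have hNc : Continuous fun z : E => ‖z - y‖ ^ 2 := by fun_prop
  have hgc : Continuous g := by fun_prop
  have hKc : IsCompact K :=
    h.isBounded.isCompact_closure.inter_right
      ((isClosed_le continuous_const hNc).inter (isClosed_le hNc continuous_const))
  have hgpos : ∀ x ∈ K, 0 < g x := by
    rintro x ⟨-, h1, h2⟩
    simp only [hg]
    nlinarith
  have hx₁K : x₁ ∈ K := by
    refine ⟨subset_closure hx₁, ?_, hx₁l.le⟩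
    by_contra! hlt
    exact absurd (hbelow x₁ (subset_closure hx₁) hlt.le) (not_le.2 hneg)
  have hcont : ContinuousOn (fun x => (kelvin u y l x - u x) / g x) K := by
    refine ContinuousOn.div (ContinuousOn.sub ?_ ?_) hgc.continuousOn fun x hx => (hgpos x hx).ne'
    · exact (h.continuousOn_kelvin_slice hl).mono fun x hx => ⟨hx.1, hx.2.2⟩
    · exact h.isSolution.2.1.mono fun x hx => hx.1
  obtain ⟨x, hxK, hxmin⟩ := hKc.exists_isMinOn ⟨x₁, hx₁K⟩ hcont
  set t : ℝ := (kelvin u y l x - u x) / g x with ht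
  have ht0 : t < 0 := by
    have h1 : t ≤ (kelvin u y l x₁ - u x₁) / g x₁ := hxmin hx₁K
    have h2 : (kelvin u y l x₁ - u x₁) / g x₁ < 0 :=
      div_neg_of_neg_of_pos (by linarith) (hgpos x₁ hx₁K)
    linarith
  have htg : kelvin u y l x - u x = t * g x := by
    rw [ht, div_mul_cancel₀ _ (hgpos x hxK).ne']
  have hneg' : kelvin u y l x < u x := by
    have := mul_neg_of_neg_of_pos ht0 (hgpos x hxK)
    linarith
  have hxc : x ∈ closure Ω := hxK.1
  have hxl : ‖x - y‖ ^ 2 < l := by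
    refine hxK.2.2.lt_of_ne fun heq => ?_
    rw [← heq, h.kelvin_eq_self hxc] at hneg'
    exact lt_irrefl _ hneg'
  have hxη : l - η < ‖x - y‖ ^ 2 := by
    by_contra! hle
    exact absurd (hbelow x hxc hle) (not_le.2 hneg')
  have hpos := h.kelvin_pos hxc hxl hl
  have hxΩ : x ∈ Ω := by
    by_contra hx'
    have : u x = 0 := h.isSolution.2.2.2.2 x ⟨hxc, by rwa [h.isOpen.interior_eq]⟩
    linarith
  have hux := h.isSolution.contDiffAt h.isOpen hxΩ
  have hkx := h.contDiffAt_kelvin hxc hxl hl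
  have hgd : ContDiff ℝ 2 g :=
    contDiff_const.sub ((((contDiff_id.sub contDiff_const).norm_sq ℝ).sub contDiff_const).pow 2)
  have hgx : ContDiffAt ℝ 2 g x := hgd.contDiffAt
  have hmin : IsLocalMin (fun z => (kelvin u y l z - u z) - t * g z) x := by
    filter_upwards [h.isOpen.mem_nhds hxΩ, hNc.continuousAt.eventually (gt_mem_nhds hxl),
      hNc.continuousAt.eventually (lt_mem_nhds hxη)] with z hz hz1 hz2
    have hzK : z ∈ K := ⟨subset_closure hz, hz2.le, hz1.le⟩
    have h1 : t ≤ (kelvin u y l z - u z) / g z := hxmin hzK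
    rw [le_div_iff₀ (hgpos z hzK)] at h1
    rw [htg]
    linarith
  have h1 := lap_le_of_touching (hkx.sub hux) (contDiffAt_const.mul hgx) hmin
  rw [lap_sub hkx hux, lap_const_mul hgx, h.isSolution.2.2.1 x hxΩ] at h1
  have h2 := h.rpow_lt_lap_kelvin hxc hxl hl
  have h3 := rpow_sub_rpow_le h.one_le hpos hneg'.le (h.le_bound x hxΩ)
  have hlapg : lap g x = 4 * n * (‖x - y‖ ^ 2 - l) + 8 * ‖x - y‖ ^ 2 := by
    rw [hg, lap_radial y x (G := fun s => 2 * η ^ 2 - (s - l) ^ 2) (G' := fun s => -(2 * (s - l)))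
      (G'' := -2)]
    · ring
    · exact contDiffAt_const.sub ((contDiffAt_id.sub contDiffAt_const).pow 2)
    · refine Eventually.of_forall fun s => ?_
      refine ((((hasDerivAt_id s).sub_const l).pow 2).const_sub (2 * η ^ 2)).congr_deriv ?_
      simp
    · refine ((((hasDerivAt_id (‖x - y‖ ^ 2)).sub_const l).const_mul 2).neg).congr_deriv ?_
      simp
  have hgle : g x ≤ 2 * η ^ 2 := by
    simp only [hg]
    nlinarith [sq_nonneg (‖x - y‖ ^ 2 - l)]
  have h4 : C * g x < lap g x := by
    have h5 : C * g x ≤ C * (2 * η) := by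
      refine mul_le_mul_of_nonneg_left (hgle.trans ?_) hC0
      nlinarith
    have hn : (0 : ℝ) ≤ n := Nat.cast_nonneg n
    have h6 : -(n * η) ≤ n * (‖x - y‖ ^ 2 - l) := by nlinarith
    rw [hlapg]
    nlinarith
  have h7 : C * (u x - kelvin u y l x) = -(t * (C * g x)) := by
    rw [show u x - kelvin u y l x = -(t * g x) by linarith]; ring
  rw [← hC, h7] at h3
  nlinarith

/-- Moving spheres: the solution lies below its Kelvin transforms inside the spheres. -/
theorem le_kelvin (h : IsMovingSphereSetup Ω u p M y d l₁) {l : ℝ} (hl : l ≤ l₁) {x : E}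
    (hx : x ∈ Ω) (hxl : ‖x - y‖ ^ 2 < l) : u x ≤ kelvin u y l x := by
  obtain ⟨η, hη0, hη⟩ := h.exists_shell
  have hNc : Continuous fun q : ℝ × E => ‖q.2 - y‖ ^ 2 := by fun_prop
  set B : Set (ℝ × E) := {q | q.1 ∈ Icc d l₁ ∧ q.2 ∈ closure Ω ∧ ‖q.2 - y‖ ^ 2 ≤ q.1 - η} with hB
  have hBc : IsCompact B := by
    have h1 := (isCompact_Icc (a := d) (b := l₁)).prod h.isBounded.isCompact_closure
    have hr : Continuous fun q : ℝ × E => q.1 - η := by fun_prop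
    have hBeq : B = (Icc d l₁ ×ˢ closure Ω) ∩ {q | ‖q.2 - y‖ ^ 2 ≤ q.1 - η} := by
      ext q
      simp [B, and_assoc]
    rw [hBeq]
    exact h1.inter_right (isClosed_le hNc hr)
  have hcont : ContinuousOn (fun q : ℝ × E => kelvin u y q.1 q.2 - u q.2) B := by
    refine ContinuousOn.sub (h.continuousOn_kelvin.mono ?_)
      (h.isSolution.2.1.comp continuousOn_snd fun q hq => hq.2.1)
    exact fun q hq => ⟨hq.1.2, hq.2.1, by linarith [hq.2.2]⟩
  set T : Set (ℝ × E) := B ∩ (fun q : ℝ × E => kelvin u y q.1 q.2 - u q.2) ⁻¹' Iic 0 with hT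
  have hTc : IsCompact T :=
    hBc.of_isClosed_subset (hcont.preimage_isClosed_of_isClosed hBc.isClosed isClosed_Iic)
      inter_subset_left
  have hgood : ∀ l', d ≤ l' → l' ≤ l₁ → (∀ z, (l', z) ∉ T) →
      ∀ z ∈ Ω, ‖z - y‖ ^ 2 < l' → u z ≤ kelvin u y l' z := by
    intro l' hd' hl' hno
    refine hη l' hd' hl' fun z hz hzl => ?_
    by_contra! hlt
    exact hno z ⟨⟨⟨hd', hl'⟩, hz, hzl⟩, by simpa using hlt.le⟩
  rcases T.eq_empty_or_nonempty with hemp | hne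
  · exact hgood l ((h.d_le x (subset_closure hx)).trans hxl.le) hl (by simp [hemp]) x hx hxl
  exfalso
  obtain ⟨⟨m, z⟩, hmz, hmin⟩ := hTc.exists_isMinOn hne continuousOn_fst
  obtain ⟨⟨⟨hdm, hml⟩, hz, hzm⟩, hle⟩ := hmz
  have hle' : kelvin u y m z ≤ u z := by simpa using hle
  simp only at hdm hml hz hzm
  refine absurd hle' (not_le.2 (h.lt_kelvin_of_le hml ?_ hz (by linarith)))
  intro x' hx' hx'm
  have hdx := h.d_le x' (subset_closure hx')
  have hlim : Tendsto (fun l' => kelvin u y l' x') (𝓝[Ioo (‖x' - y‖ ^ 2) m] m)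
      (𝓝 (kelvin u y m x')) := by
    have hc : ContinuousOn (fun l' => kelvin u y l' x') (Icc (‖x' - y‖ ^ 2) m) :=
      h.continuousOn_kelvin.comp (f := fun l' : ℝ => (l', x')) (by fun_prop)
        fun l' hl' => ⟨hl'.2.trans hml, subset_closure hx', hl'.1⟩
    exact (hc m ⟨hx'm.le, le_rfl⟩).mono Ioo_subset_Icc_self
  have : (𝓝[Ioo (‖x' - y‖ ^ 2) m] m).NeBot := by
    rw [nhdsWithin_Ioo_eq_nhdsLT hx'm]; infer_instance
  refine ge_of_tendsto hlim ?_
  filter_upwards [self_mem_nhdsWithin] with l' hl'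
  refine hgood l' (hdx.trans hl'.1.le) (hl'.2.le.trans hml) (fun z' hz' => ?_) x' hx' hl'.1
  have : m ≤ l' := hmin hz'
  exact absurd hl'.2 (not_lt.2 this)

end IsMovingSphereSetup

end MovingSpheres

section Barriers

variable {n : ℕ}

local notation "E" => EuclideanSpace ℝ (Fin n)

theorem contDiff_norm_sq_sub (y : E) : ContDiff ℝ 2 fun z : E => ‖z - y‖ ^ 2 :=
  (contDiff_id.sub contDiff_const).norm_sq ℝ

theorem norm_sub_lt_of_sq_lt {x q : E} {R : ℝ} (hR : 0 < R) (h : 0 < R ^ 2 - ‖x - q‖ ^ 2) :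
    x ∈ ball q R := by
  rw [mem_ball, dist_eq_norm]
  exact lt_of_pow_lt_pow_left₀ 2 hR.le (by linarith)

theorem sq_sub_nonneg_of_mem_closedBall {x q : E} {R : ℝ} (h : x ∈ closedBall q R) :
    0 ≤ R ^ 2 - ‖x - q‖ ^ 2 := by
  rw [mem_closedBall, dist_eq_norm] at h
  have := pow_le_pow_left₀ (norm_nonneg _) h 2
  linarith

theorem le_center_of_le_lap (hn : 0 < n) {u : E → ℝ} {q : E} {R c : ℝ} (hR : 0 < R)
    (hc : 0 < c) (hu : ∀ x ∈ closedBall q R, ContDiffAt ℝ 2 u x)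
    (hu0 : ∀ x ∈ closedBall q R, 0 ≤ u x) (hlap : ∀ x ∈ closedBall q R, c ≤ lap u x) :
    c * R ^ 2 / (4 * n) ≤ u q := by
  have hn' : (0 : ℝ) < n := by exact_mod_cast hn
  set b : ℝ := c / (4 * n) with hb
  have hb0 : 0 < b := by positivity
  have hgc : ContDiff ℝ 2 fun z : E => b * (R ^ 2 - ‖z - q‖ ^ 2) :=
    contDiff_const.mul (contDiff_const.sub (contDiff_norm_sq_sub q))
  have hcont : ContinuousOn (fun z => u z - b * (R ^ 2 - ‖z - q‖ ^ 2)) (closedBall q R) :=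
    ContinuousOn.sub (fun x hx => (hu x hx).continuousAt.continuousWithinAt)
      hgc.continuous.continuousOn
  obtain ⟨x, hx, hmin⟩ := (isCompact_closedBall q R).exists_isMinOn
    ⟨q, mem_closedBall_self hR.le⟩ hcont
  have hq : u x - b * (R ^ 2 - ‖x - q‖ ^ 2) ≤ u q - b * R ^ 2 := by
    simpa using hmin (mem_closedBall_self hR.le)
  have hgoal : c * R ^ 2 / (4 * n) = b * R ^ 2 := by rw [hb]; ring
  rw [hgoal]
  by_contra! hlt
  have hpos : 0 < R ^ 2 - ‖x - q‖ ^ 2 := by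
    have h1 := hu0 x hx
    by_contra! hle
    nlinarith
  have hxb := norm_sub_lt_of_sq_lt hR hpos
  have hloc : IsLocalMin (fun z => u z - b * (R ^ 2 - ‖z - q‖ ^ 2)) x :=
    hmin.isLocalMin (Filter.mem_of_superset (isOpen_ball.mem_nhds hxb) ball_subset_closedBall)
  have h1 := lap_le_of_touching (hu x hx) hgc.contDiffAt hloc
  rw [lap_const_mul (contDiff_const.sub (contDiff_norm_sq_sub q)).contDiffAt,
    lap_radial q x (G := fun s => R ^ 2 - s) (G' := fun _ => -1) (G'' := 0)
      (contDiffAt_const.sub contDiffAt_id)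
      (Eventually.of_forall fun s => (hasDerivAt_id s).const_sub _) (hasDerivAt_const _ _)] at h1
  have h2 := hlap x hx
  have h3 : b * (4 * n) = c := by rw [hb]; field_simp
  nlinarith

theorem le_of_lap_le {Ω : Set E} (hΩo : IsOpen Ω) (hΩb : Bornology.IsBounded Ω) {w β : E → ℝ}
    {c : ℝ} (hc : 0 < c) (hw : ∀ x ∈ Ω, ContDiffAt ℝ 2 w x) (hwc : ContinuousOn w (closure Ω))
    (hw0 : ∀ x ∈ frontier Ω, w x = 0) (hwl : ∀ x ∈ Ω, lap w x ≤ c) (hβ : ContDiff ℝ 2 β)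
    (hβ0 : ∀ x ∈ closure Ω, 0 ≤ β x) (hβl : ∀ x ∈ Ω, 1 < lap β x) :
    ∀ x ∈ Ω, w x ≤ c * β x := by
  intro x₁ hx₁
  by_contra! hlt
  have hcont : ContinuousOn (fun z => c * β z - w z) (closure Ω) :=
    (continuousOn_const.mul hβ.continuous.continuousOn).sub hwc
  obtain ⟨x, hx, hmin⟩ := hΩb.isCompact_closure.exists_isMinOn ⟨x₁, subset_closure hx₁⟩ hcont
  have hneg : c * β x - w x < 0 :=
    lt_of_le_of_lt (hmin (subset_closure hx₁)) (by simpa using hlt)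
  have hxΩ : x ∈ Ω := by
    by_contra hx'
    have h0 := hw0 x ⟨hx, by rwa [hΩo.interior_eq]⟩
    have := mul_nonneg hc.le (hβ0 x hx)
    linarith
  have hloc : IsLocalMin (fun z => c * β z - w z) x :=
    hmin.isLocalMin (Filter.mem_of_superset (hΩo.mem_nhds hxΩ) subset_closure)
  have h1 := lap_le_of_touching (contDiffAt_const.mul hβ.contDiffAt) (hw x hxΩ) hloc
  rw [lap_const_mul hβ.contDiffAt] at h1
  have h2 := hβl x hxΩ
  have h3 := hwl x hxΩ
  nlinarith

theorem exists_barrier {Ω : Set E} (hΩb : Bornology.IsBounded Ω) (hn : 0 < n)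
    {y z : E} {r : ℝ} (hr : 0 < r) (hz : ‖z - y‖ = r) (hΩ : ∀ x ∈ closure Ω, r ≤ ‖x - y‖) :
    ∃ β : E → ℝ, ContDiff ℝ 2 β ∧ (∀ x ∈ closure Ω, 0 ≤ β x) ∧ β z = 0 ∧
      ∀ x ∈ Ω, 1 < lap β x := by
  obtain ⟨D, hD⟩ := hΩb.exists_norm_le
  have hn' : (0 : ℝ) < n := by exact_mod_cast hn
  set k : ℝ := n / r ^ 2 with hk
  have hk0 : 0 < k := by positivity
  set S : ℝ := (D + ‖y‖) ^ 2 - r ^ 2 with hS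
  set A : ℝ := Real.exp (k * S) / (n * k) with hA
  have hA0 : 0 < A := by positivity
  have hsq : ∀ x ∈ closure Ω, r ^ 2 ≤ ‖x - y‖ ^ 2 := fun x hx =>
    pow_le_pow_left₀ hr.le (hΩ x hx) 2
  have hGc : ContDiff ℝ 2 fun s : ℝ => A * (1 - Real.exp (-k * (s - r ^ 2))) :=
    contDiff_const.mul (contDiff_const.sub
      ((contDiff_const.mul (contDiff_id.sub contDiff_const)).exp))
  refine ⟨fun x => A * (1 - Real.exp (-k * (‖x - y‖ ^ 2 - r ^ 2))),
    hGc.comp (contDiff_norm_sq_sub y), fun x hx => ?_, by simp [hz], fun x hx => ?_⟩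
  · have : Real.exp (-k * (‖x - y‖ ^ 2 - r ^ 2)) ≤ 1 := by
      rw [Real.exp_le_one_iff]
      nlinarith [hsq x hx]
    nlinarith
  · have hE : ∀ s : ℝ, HasDerivAt (fun s : ℝ => Real.exp (-k * (s - r ^ 2)))
        (Real.exp (-k * (s - r ^ 2)) * -k) s := fun s => by
      simpa using ((((hasDerivAt_id s).sub_const (r ^ 2)).const_mul (-k)).exp)
    rw [lap_radial y x (G := fun s => A * (1 - Real.exp (-k * (s - r ^ 2))))
      (G' := fun s => A * -(Real.exp (-k * (s - r ^ 2)) * -k))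
      (G'' := A * -(Real.exp (-k * (‖x - y‖ ^ 2 - r ^ 2)) * -k * -k))
      hGc.contDiffAt (Eventually.of_forall fun s => ((hE s).const_sub 1).const_mul A)
      ((((hE (‖x - y‖ ^ 2)).mul_const (-k)).neg).const_mul A)]
    set e := Real.exp (-k * (‖x - y‖ ^ 2 - r ^ 2)) with he
    have hxD : ‖x - y‖ ^ 2 - r ^ 2 ≤ S := by
      have h1 : ‖x - y‖ ≤ D + ‖y‖ := (norm_sub_le x y).trans (by linarith [hD x hx])
      have := pow_le_pow_left₀ (norm_nonneg _) h1 2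
      rw [hS]; linarith
    have hAe : 1 ≤ A * e * (n * k) := by
      have h1 : A * e * (n * k) = Real.exp (k * S) * e := by rw [hA]; field_simp
      rw [h1, he, ← Real.exp_add]
      refine Real.one_le_exp ?_
      nlinarith
    have hkr : n ≤ k * ‖x - y‖ ^ 2 := by
      have h1 : k * r ^ 2 = n := by rw [hk]; field_simp
      rw [← h1]
      exact mul_le_mul_of_nonneg_left (hsq x (subset_closure hx)) hk0.le
    have hAek : 0 < A * e * k := by positivity
    have : -(2 * n * (A * -(e * -k)) + 4 * ‖x - y‖ ^ 2 * (A * -(e * -k * -k))) =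
        A * e * k * (4 * (k * ‖x - y‖ ^ 2) - 2 * n) := by ring
    rw [this]
    nlinarith

/-- A sublinear solution cannot be small on a ball. -/
theorem rpow_sub_one_le_of_le_one {u : E → ℝ} {q : E} {R p M : ℝ} (hR : 0 < R) (hp : p ≤ 1)
    (hu : ∀ x ∈ closedBall q R, ContDiffAt ℝ 2 u x) (hu0 : ∀ x ∈ closedBall q R, 0 < u x)
    (huM : ∀ x ∈ closedBall q R, u x ≤ M) (hlap : ∀ x ∈ closedBall q R, lap u x = u x ^ p) :
    M ^ (p - 1) ≤ (n + 2) ^ 2 / (2 * R ^ 2) := by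
  set g : E → ℝ := fun z => R ^ 2 - ‖z - q‖ ^ 2 with hg
  have hgc : ContDiff ℝ 2 fun z => (g z) ^ 2 :=
    (contDiff_const.sub (contDiff_norm_sq_sub q)).pow 2
  have hcont : ContinuousOn (fun z => (g z) ^ 2 / u z) (closedBall q R) :=
    hgc.continuous.continuousOn.div
      (fun x hx => (hu x hx).continuousAt.continuousWithinAt) fun x hx => (hu0 x hx).ne'
  have hqb : q ∈ closedBall q R := mem_closedBall_self hR.le
  obtain ⟨x, hx, hmax⟩ := (isCompact_closedBall q R).exists_isMaxOn ⟨q, hqb⟩ hcont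
  set t : ℝ := (g x) ^ 2 / u x with ht
  have hux := hu0 x hx
  have htq : (g q) ^ 2 / u q ≤ t := hmax hqb
  have ht0 : 0 < t := by
    refine lt_of_lt_of_le ?_ htq
    have := hu0 q hqb
    have hgq : g q = R ^ 2 := by simp [hg]
    rw [hgq]
    positivity
  have htu : t * u x = (g x) ^ 2 := by rw [ht, div_mul_cancel₀ _ hux.ne']
  have hgx : 0 < g x := by
    refine (sq_sub_nonneg_of_mem_closedBall hx).lt_of_ne fun h0 => ?_
    have : g x = 0 := h0.symm
    rw [this] at htu
    have := mul_pos ht0 hux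
    linarith
  have hxb := norm_sub_lt_of_sq_lt hR hgx
  have hloc : IsLocalMin (fun z => t * u z - (g z) ^ 2) x := by
    filter_upwards [isOpen_ball.mem_nhds hxb] with z hz
    have hz' := ball_subset_closedBall hz
    have h1 : (g z) ^ 2 / u z ≤ t := hmax hz'
    rw [div_le_iff₀ (hu0 z hz')] at h1
    linarith
  have h1 := lap_le_of_touching (contDiffAt_const.mul (hu x hx)) hgc.contDiffAt hloc
  have hG : ∀ s : ℝ, HasDerivAt (fun s : ℝ => (R ^ 2 - s) ^ 2) (-(2 * (R ^ 2 - s))) s := fun s => by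
    refine (((hasDerivAt_id s).const_sub (R ^ 2)).pow 2).congr_deriv ?_
    simp
  rw [lap_const_mul (hu x hx), hlap x hx, hg, lap_radial q x (G := fun s => (R ^ 2 - s) ^ 2)
    (G' := fun s => -(2 * (R ^ 2 - s))) (G'' := -(2 * -1))
    ((contDiff_const.sub contDiff_id).pow 2).contDiffAt (Eventually.of_forall hG)
    (((hasDerivAt_id _).const_sub _).const_mul 2).neg] at h1
  set C : ℝ := (n + 2) ^ 2 / (2 * R ^ 2) with hC
  have h2 : -(2 * n * -(2 * (R ^ 2 - ‖x - q‖ ^ 2)) + 4 * ‖x - q‖ ^ 2 * -(2 * -1)) ≤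
      C * (g x) ^ 2 := by
    have h3 : C * (g x) ^ 2 - ((4 * n + 8) * g x - 8 * R ^ 2) =
        ((n + 2) * g x - 4 * R ^ 2) ^ 2 / (2 * R ^ 2) := by
      rw [hC]; field_simp; ring
    have h4 : 0 ≤ ((n + 2) * g x - 4 * R ^ 2) ^ 2 / (2 * R ^ 2) := by positivity
    have h5 : ‖x - q‖ ^ 2 = R ^ 2 - g x := by simp [hg]
    rw [h5]
    nlinarith
  have h6 : u x ^ p ≤ C * u x := by
    have : t * u x ^ p ≤ t * (C * u x) := by
      rw [show t * (C * u x) = C * (t * u x) by ring, htu]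
      exact h1.trans h2
    exact le_of_mul_le_mul_left this ht0
  have h7 : u x ^ (p - 1) ≤ C := by
    rw [Real.rpow_sub_one hux.ne', div_le_iff₀ hux]
    exact h6
  exact (Real.rpow_le_rpow_of_nonpos hux (huM x hx) (by linarith)).trans h7

/-- For nonincreasing nonlinearities the lower bound is linear in the exponent `1 - p`. -/
theorem le_rpow_one_sub {u : E → ℝ} {q : E} {R p M : ℝ} (hR : 0 < R) (hp : p < 1)
    (hu : ∀ x ∈ closedBall q R, ContDiffAt ℝ 2 u x) (hu0 : ∀ x ∈ closedBall q R, 0 < u x)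
    (huM : ∀ x ∈ closedBall q R, u x ≤ M) (hlap : ∀ x ∈ closedBall q R, lap u x = u x ^ p) :
    (1 - p) * (R ^ 2 / (4 * n + 8)) ≤ M ^ (1 - p) := by
  set a : ℝ := 1 - p with ha
  have ha0 : 0 < a := by linarith
  set g : E → ℝ := fun z => R ^ 2 - ‖z - q‖ ^ 2 with hg
  have hgc : ContDiff ℝ 2 g := contDiff_const.sub (contDiff_norm_sq_sub q)
  have hpow : ∀ x ∈ closedBall q R, 0 < u x ^ a := fun x hx => Real.rpow_pos_of_pos (hu0 x hx) a
  have hcont : ContinuousOn (fun z => (g z) ^ 2 / u z ^ a) (closedBall q R) := by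
    refine (hgc.continuous.pow 2).continuousOn.div ?_ fun x hx => (hpow x hx).ne'
    exact ContinuousOn.rpow_const (fun x hx => (hu x hx).continuousAt.continuousWithinAt)
      fun x hx => Or.inl (hu0 x hx).ne'
  have hqb : q ∈ closedBall q R := mem_closedBall_self hR.le
  obtain ⟨x, hx, hmax⟩ := (isCompact_closedBall q R).exists_isMaxOn ⟨q, hqb⟩ hcont
  have hux := hu0 x hx
  have hq : (R ^ 2) ^ 2 / u q ^ a ≤ (g x) ^ 2 / u x ^ a := by
    have : (g q) ^ 2 / u q ^ a ≤ (g x) ^ 2 / u x ^ a := hmax hqb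
    simpa [hg] using this
  have hgx : 0 < g x := by
    refine (sq_sub_nonneg_of_mem_closedBall hx).lt_of_ne fun h0 => ?_
    have h0' : g x = 0 := h0.symm
    rw [h0'] at hq
    have := hpow q hqb
    have h3 : 0 < (R ^ 2) ^ 2 / u q ^ a := by positivity
    simp at hq
    linarith
  have hxb := norm_sub_lt_of_sq_lt hR hgx
  have hgpos : ∀ᶠ z in 𝓝 x, 0 < g z := hgc.continuous.continuousAt.eventually (lt_mem_nhds hgx)
  have hloc : IsLocalMin (fun z => a * Real.log (u z) - 2 * Real.log (g z)) x := by
    filter_upwards [isOpen_ball.mem_nhds hxb, hgpos] with z hz hgz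
    have hz' := ball_subset_closedBall hz
    have h1 : (g z) ^ 2 / u z ^ a ≤ (g x) ^ 2 / u x ^ a := hmax hz'
    have hpz := hpow z hz'
    have hpx := hpow x hx
    have h2 := Real.log_le_log (by positivity) h1
    rw [Real.log_div (by positivity) hpz.ne', Real.log_div (by positivity) hpx.ne',
      Real.log_pow, Real.log_pow, Real.log_rpow (hu0 z hz'), Real.log_rpow hux] at h2
    push_cast at h2
    linarith
  have hulog : ContDiffAt ℝ 2 (fun z => Real.log (u z)) x := (hu x hx).log hux.ne'
  have hglog : ContDiffAt ℝ 2 (fun z => Real.log (g z)) x := hgc.contDiffAt.log hgx.ne'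
  have h1 := lap_le_of_touching (contDiffAt_const.mul hulog) (contDiffAt_const.mul hglog) hloc
  rw [lap_const_mul hulog, lap_const_mul hglog] at h1
  have h2 : u x ^ (p - 1) ≤ lap (fun z => Real.log (u z)) x := by
    rw [lap_comp (hu x hx) (G := Real.log) (G' := fun s => s⁻¹) (G'' := -(u x ^ 2)⁻¹)
      (Real.contDiffAt_log.2 hux.ne')
      ((eventually_ne_nhds hux.ne').mono fun s hs => Real.hasDerivAt_log hs)
      (hasDerivAt_inv hux.ne'), hlap x hx, Real.rpow_sub_one hux.ne', div_eq_inv_mul]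
    have : 0 ≤ (u x ^ 2)⁻¹ * ∑ i : Fin n, (fderiv ℝ u x (EuclideanSpace.single i 1)) ^ 2 := by
      positivity
    linarith
  have h3 : lap (fun z => Real.log (g z)) x ≤ (2 * n + 4) * R ^ 2 / (g x) ^ 2 := by
    have hgx' : R ^ 2 - ‖x - q‖ ^ 2 ≠ 0 := hgx.ne'
    have hev : ∀ᶠ s in 𝓝 (‖x - q‖ ^ 2), R ^ 2 - s ≠ 0 :=
      ((continuous_const.sub continuous_id).continuousAt (x := ‖x - q‖ ^ 2)).eventually_ne hgx'
    change lap (fun z => Real.log (R ^ 2 - ‖z - q‖ ^ 2)) x ≤ _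
    rw [lap_radial q x (G := fun s => Real.log (R ^ 2 - s)) (G' := fun s => -1 / (R ^ 2 - s))
      (G'' := (0 * (R ^ 2 - ‖x - q‖ ^ 2) - -1 * -1) / (R ^ 2 - ‖x - q‖ ^ 2) ^ 2)
      ((contDiffAt_const.sub contDiffAt_id).log hgx')
      (hev.mono fun s hs => ((hasDerivAt_id s).const_sub (R ^ 2)).log hs)
      ((hasDerivAt_const _ _).div ((hasDerivAt_id _).const_sub (R ^ 2)) hgx')]
    have h5 : ‖x - q‖ ^ 2 = R ^ 2 - g x := by simp [hg]
    have h6 : (0 : ℝ) ≤ ‖x - q‖ ^ 2 := by positivity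
    rw [h5] at h6 ⊢
    have hgR : g x ≤ R ^ 2 := by linarith
    have hn : (0 : ℝ) ≤ n := Nat.cast_nonneg n
    have h8 : -(2 * n * (-1 / (R ^ 2 - (R ^ 2 - g x))) + 4 * (R ^ 2 - g x) *
        ((0 * (R ^ 2 - (R ^ 2 - g x)) - -1 * -1) / (R ^ 2 - (R ^ 2 - g x)) ^ 2)) =
        (2 * n * g x + 4 * (R ^ 2 - g x)) / g x ^ 2 := by
      simp only [sub_sub_cancel]
      field_simp
      ring
    rw [h8]
    gcongr
    nlinarith
  have hu' : u x ^ (p - 1) = (u x ^ a)⁻¹ := by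
    rw [← Real.rpow_neg hux.le, ha]; ring_nf
  have hpx := hpow x hx
  have hpq := hpow q hqb
  have h4 : a * (u x ^ a)⁻¹ ≤ 2 * ((2 * n + 4) * R ^ 2 / (g x) ^ 2) := by
    rw [← hu']
    nlinarith
  have h5 : a * (g x ^ 2 / u x ^ a) ≤ (4 * n + 8) * R ^ 2 := by
    have := mul_le_mul_of_nonneg_right h4 (sq_nonneg (g x))
    have e1 : a * (u x ^ a)⁻¹ * g x ^ 2 = a * (g x ^ 2 / u x ^ a) := by ring
    have e2 : 2 * ((2 * n + 4) * R ^ 2 / (g x) ^ 2) * g x ^ 2 = (4 * n + 8) * R ^ 2 := by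
      field_simp; ring
    rwa [e1, e2] at this
  have h6 : a * ((R ^ 2) ^ 2 / u q ^ a) ≤ (4 * n + 8) * R ^ 2 :=
    (mul_le_mul_of_nonneg_left hq ha0.le).trans h5
  have h7 : a * (R ^ 2 / (4 * n + 8)) ≤ u q ^ a := by
    rw [← mul_div_assoc, div_le_iff₀ hpq] at h6
    rw [← mul_div_assoc, div_le_iff₀ (by positivity)]
    have hR2 : 0 < R ^ 2 := by positivity
    nlinarith
  exact h7.trans (Real.rpow_le_rpow (hu0 q hqb).le (huM q hqb) ha0.le)

end Barriers

section BoundaryGeometry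

variable {n : ℕ}

local notation "E" => EuclideanSpace ℝ (Fin n)

theorem clm_sub_neg_of_near {φ ψ : E →L[ℝ] ℝ} {G x y z y₀ : E} {r : ℝ} (hr : 0 < r)
    (hG : 0 < ‖G‖) (hGφ : ∀ w, φ w = inner ℝ G w) (hφG : ‖φ‖ = ‖G‖)
    (hy₀ : y₀ = z + (r / ‖G‖) • G) (hψ : ‖ψ - φ‖ ≤ ‖G‖ / 16) (hxz : ‖x - z‖ ≤ r / 8)
    (hy : ‖y - y₀‖ ≤ r / 1024) (hxy : ‖x - y‖ ≤ 2 * r) : ψ (x - y) < 0 := by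
  have h1 : φ (z - y₀) = -(r * ‖G‖) := by
    rw [hGφ, hy₀, sub_add_cancel_left, inner_neg_right, inner_smul_right,
      real_inner_self_eq_norm_sq]
    field_simp
  have h2 : ψ (x - y) = (ψ - φ) (x - y) + (φ (z - y₀) + φ ((x - z) - (y - y₀))) := by
    have h : z - y₀ + (x - z - (y - y₀)) = x - y := by abel
    rw [← map_add, h]
    simp
  have h3 : (ψ - φ) (x - y) ≤ ‖G‖ / 16 * (2 * r) :=
    (le_abs_self _).trans (((ψ - φ).le_opNorm (x - y)).trans (by gcongr))
  have h4 : φ ((x - z) - (y - y₀)) ≤ ‖G‖ * (r / 8 + r / 1024) := by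
    refine (le_abs_self _).trans ((φ.le_opNorm _).trans ?_)
    rw [hφG]
    have h5 : ‖(x - z) - (y - y₀)‖ ≤ r / 8 + r / 1024 :=
      (norm_sub_le _ _).trans (add_le_add hxz hy)
    gcongr
  have h6 : 0 < r * ‖G‖ := by positivity
  rw [h2, h1]
  linarith

/-- Near a boundary point there is an exterior touching ball, and dilations with centre close to
the centre of that ball push the part of the closure near the ball into the domain. -/
theorem HasSmoothBoundary.exists_exterior_ball {Ω : Set E} (hΩo : IsOpen Ω)
    (hΩs : HasSmoothBoundary Ω) {z : E} (hz : z ∈ frontier Ω) :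
    ∃ (y₀ : E) (r : ℝ), 0 < r ∧ ‖z - y₀‖ = r ∧ (∀ x ∈ closure Ω, r ≤ ‖x - y₀‖) ∧
      ∀ y : E, ‖y - y₀‖ ≤ r / 1024 → ∀ x ∈ closure Ω, ∀ s : ℝ, 1 < s →
        s * ‖x - y‖ ^ 2 ≤ (r + r / 1024) ^ 2 → y + s • (x - y) ∈ Ω := by
  obtain ⟨U, f, hUo, hzU, hf, hfU, hUf⟩ := hΩs z hz
  have hfd : Differentiable ℝ f := hf.differentiable (by simp)
  have hmem : ∀ x ∈ U, f x < 0 → x ∈ Ω := fun x hx hfx => by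
    have : x ∈ {y | y ∈ U ∧ f y < 0} := ⟨hx, hfx⟩
    rw [← hUf] at this
    exact this.1
  have hcl : ∀ x ∈ closure Ω, x ∈ U → f x ≤ 0 := fun x hx hxU => by
    have h1 : x ∈ closure (U ∩ Ω) := hUo.inter_closure ⟨hxU, hx⟩
    refine closure_minimal ?_ (isClosed_le hf.continuous continuous_const) h1
    rintro w ⟨hwU, hwΩ⟩
    have : w ∈ Ω ∩ U := ⟨hwΩ, hwU⟩
    rw [hUf] at this
    exact this.2.le
  have hzΩ : z ∉ Ω := by
    have := hz.2
    rwa [hΩo.interior_eq] at this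
  have hfz : f z = 0 := by
    refine le_antisymm (hcl z hz.1 hzU) ?_
    by_contra! h
    exact hzΩ (hmem z hzU h)
  set φ := fderiv ℝ f z with hφ
  set G : E := (InnerProductSpace.toDual ℝ E).symm φ with hG
  have hGφ : ∀ w, φ w = inner ℝ G w := fun w => by rw [hG, InnerProductSpace.toDual_symm_apply]
  have hφG : ‖φ‖ = ‖G‖ := by rw [hG, LinearIsometryEquiv.norm_map]
  have hG0 : 0 < ‖G‖ := by rw [← hφG]; exact norm_pos_iff.2 (hfU z hzU)
  have hf1 : ContDiffAt ℝ 1 (fderiv ℝ f) z :=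
    ((contDiff_infty.1 hf 2 : ContDiff ℝ 2 f).contDiffAt
      (x := z)).fderiv_right (by norm_num)
  obtain ⟨K, t, ht, hK⟩ := hf1.exists_lipschitzOnWith
  obtain ⟨τ, hτ, hτb⟩ := Metric.mem_nhds_iff.1 (Filter.inter_mem ht (hUo.mem_nhds hzU))
  have hzt : z ∈ t := mem_of_mem_nhds ht
  have hlip : ∀ x ∈ ball z τ, ‖fderiv ℝ f x - φ‖ ≤ K * ‖x - z‖ := fun x hx => by
    have := hK.dist_le_mul x (hτb hx).1 z hzt
    rwa [dist_eq_norm, dist_eq_norm] at this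
  have hK0 : (0 : ℝ) ≤ K := K.2
  have htaylor : ∀ x ∈ ball z τ, ‖f x - f z - φ (x - z)‖ ≤ K * ‖x - z‖ * ‖x - z‖ := by
    intro x hx
    have hxz : x ∈ closedBall z ‖x - z‖ := by simp [dist_eq_norm]
    refine (convex_closedBall z ‖x - z‖).norm_image_sub_le_of_norm_hasFDerivWithin_le'
      (f' := fderiv ℝ f) (fun w _ => (hfd w).hasFDerivAt.hasFDerivWithinAt) (fun w hw => ?_)
      (mem_closedBall_self (norm_nonneg _)) hxz
    rw [mem_closedBall, dist_eq_norm] at hw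
    rw [mem_ball, dist_eq_norm] at hx
    refine (hlip w (by rw [mem_ball, dist_eq_norm]; linarith)).trans ?_
    gcongr
  set r : ℝ := min (τ / 4) (‖G‖ / (4 * (K + 1))) with hr
  have hr0 : 0 < r := lt_min (by positivity) (by positivity)
  have hrτ : 4 * r ≤ τ := by linarith [min_le_left (τ / 4) (‖G‖ / (4 * (K + 1)))]
  have hrK : 4 * r * K ≤ ‖G‖ := by
    have h1 : r ≤ ‖G‖ / (4 * (K + 1)) := min_le_right _ _
    rw [le_div_iff₀ (by positivity)] at h1
    nlinarith
  set y₀ : E := z + (r / ‖G‖) • G with hy₀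
  have hzy : ‖z - y₀‖ = r := by
    rw [hy₀, sub_add_cancel_left, norm_neg, norm_smul, Real.norm_of_nonneg (by positivity)]
    field_simp
  have hin : ∀ x ∈ closure Ω, x ∈ ball z τ → r ^ 2 + ‖x - z‖ ^ 2 / 2 ≤ ‖x - y₀‖ ^ 2 := by
    intro x hx hxb
    have h1 := htaylor x hxb
    have h2 := hcl x hx (hτb hxb).2
    rw [hfz, sub_zero, hGφ] at h1
    have h3 : inner ℝ G (x - z) ≤ K * ‖x - z‖ ^ 2 := by
      have := neg_le_of_abs_le h1
      nlinarith
    have h4 : ‖x - y₀‖ ^ 2 = ‖x - z‖ ^ 2 - 2 * ((r / ‖G‖) * inner ℝ G (x - z)) + r ^ 2 := by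
      have e1 : x - y₀ = (x - z) - (r / ‖G‖) • G := by rw [hy₀]; abel
      rw [e1, norm_sub_sq_real, inner_smul_right, norm_smul,
        Real.norm_of_nonneg (by positivity : (0 : ℝ) ≤ r / ‖G‖), real_inner_comm,
        div_mul_cancel₀ _ hG0.ne']
    have h5 : (r / ‖G‖) * inner ℝ G (x - z) ≤ ‖x - z‖ ^ 2 / 4 := by
      calc (r / ‖G‖) * inner ℝ G (x - z) ≤ (r / ‖G‖) * (K * ‖x - z‖ ^ 2) := by gcongr
        _ = (4 * r * K) * ‖x - z‖ ^ 2 / (4 * ‖G‖) := by field_simp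
        _ ≤ ‖G‖ * ‖x - z‖ ^ 2 / (4 * ‖G‖) := by gcongr
        _ = ‖x - z‖ ^ 2 / 4 := by field_simp
    rw [h4]
    linarith
  have hout : ∀ x, x ∉ ball z τ → 3 * r ≤ ‖x - y₀‖ := by
    intro x hx
    rw [mem_ball, dist_eq_norm, not_lt] at hx
    have h1 : ‖x - z‖ ≤ ‖x - y₀‖ + ‖z - y₀‖ := by
      rw [show x - z = (x - y₀) - (z - y₀) by abel]
      exact norm_sub_le _ _
    linarith
  have hext : ∀ x ∈ closure Ω, r ≤ ‖x - y₀‖ := by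
    intro x hx
    by_cases hxb : x ∈ ball z τ
    · refine (sq_le_sq₀ hr0.le (norm_nonneg _)).1 ?_
      have := hin x hx hxb
      have h2 : 0 ≤ ‖x - z‖ ^ 2 := by positivity
      linarith
    · linarith [hout x hxb]
  refine ⟨y₀, r, hr0, hzy, hext, fun y hy x hx s hs hsl => ?_⟩
  have hxy1 : ‖x - y‖ ≤ r + r / 1024 := by
    refine (sq_le_sq₀ (norm_nonneg _) (by positivity)).1 (le_trans ?_ hsl)
    nlinarith [sq_nonneg ‖x - y‖]
  have htri : ‖x - y₀‖ ≤ ‖x - y‖ + ‖y - y₀‖ := by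
    rw [show x - y₀ = (x - y) + (y - y₀) by abel]
    exact norm_add_le _ _
  have hxy2 : r - r / 1024 ≤ ‖x - y‖ := by linarith [hext x hx]
  have hxb : x ∈ ball z τ := by
    by_contra hxb
    linarith [hout x hxb]
  have hxz : ‖x - z‖ ≤ r / 8 := by
    refine (sq_le_sq₀ (norm_nonneg _) (by positivity)).1 ?_
    have h1 := hin x hx hxb
    have h2 : ‖x - y₀‖ ^ 2 ≤ (r + 2 * (r / 1024)) ^ 2 :=
      pow_le_pow_left₀ (norm_nonneg _) (by linarith) 2
    nlinarith
  have hs1 : (s - 1) * ‖x - y‖ ≤ r / 8 := by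
    have h1 : (s - 1) * ‖x - y‖ * (r - r / 1024) ≤ (s - 1) * ‖x - y‖ * ‖x - y‖ := by
      have : 0 ≤ (s - 1) * ‖x - y‖ := mul_nonneg (by linarith) (norm_nonneg _)
      gcongr
    have h2 : (r - r / 1024) ^ 2 ≤ ‖x - y‖ ^ 2 := pow_le_pow_left₀ (by linarith) hxy2 2
    by_contra! hlt
    have h3 : r / 8 * (r - r / 1024) ≤ (s - 1) * ‖x - y‖ * (r - r / 1024) := by
      have : 0 ≤ r - r / 1024 := by linarith
      gcongr
    have h4 : (s - 1) * ‖x - y‖ * ‖x - y‖ = s * ‖x - y‖ ^ 2 - ‖x - y‖ ^ 2 := by ring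
    have h5 : 0 < r ^ 2 := by positivity
    nlinarith only [h1, h2, h3, h4, h5, hsl]
  set x' : E := y + s • (x - y) with hx'
  have hx'x : x' - x = (s - 1) • (x - y) := by rw [hx', sub_smul, one_smul]; abel
  have hx'z : ‖x' - z‖ ≤ r / 4 := by
    have h1 : ‖x' - x‖ ≤ r / 8 := by
      rw [hx'x, norm_smul, Real.norm_of_nonneg (by linarith)]
      exact hs1
    rw [show x' - z = (x' - x) + (x - z) by abel]
    exact (norm_add_le _ _).trans (by linarith)
  have hball : closedBall z (r / 4) ⊆ ball z τ := closedBall_subset_ball (by linarith)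
  have hxB : x ∈ closedBall z (r / 4) := by rw [mem_closedBall, dist_eq_norm]; linarith
  have hx'B : x' ∈ closedBall z (r / 4) := by rwa [mem_closedBall, dist_eq_norm]
  obtain ⟨c, hc, hmvt⟩ := domain_mvt (f := f) (f' := fderiv ℝ f) (s := closedBall z (r / 4))
    (fun w _ => (hfd w).hasFDerivAt.hasFDerivWithinAt) (convex_closedBall z (r / 4)) hxB hx'B
  have hcB : c ∈ closedBall z (r / 4) := (convex_closedBall z (r / 4)).segment_subset hxB hx'B hc
  have hdir : fderiv ℝ f c (x - y) < 0 := by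
    have hcz : ‖c - z‖ ≤ r / 4 := by rwa [mem_closedBall, dist_eq_norm] at hcB
    refine clm_sub_neg_of_near hr0 hG0 hGφ hφG hy₀ ?_ hxz hy (by linarith)
    have h1 : K * ‖c - z‖ ≤ K * (r / 4) := by gcongr
    linarith [hlip c (hball hcB)]
  have hfx' : f x' < 0 := by
    have h1 := hcl x hx (hτb hxb).2
    rw [hx'x, map_smul, smul_eq_mul] at hmvt
    have : (s - 1) * fderiv ℝ f c (x - y) < 0 := mul_neg_of_pos_of_neg (by linarith) hdir
    linarith
  exact hmem x' (hτb (hball hx'B)).2 hfx'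

end BoundaryGeometry

section MaximumPoints

variable {n : ℕ}

local notation "E" => EuclideanSpace ℝ (Fin n)

/-- If a solution attains its maximum near the touching point of an exterior ball, then it is
comparable to its maximum on a ball of controlled radius. -/
theorem IsSolution.max_le_mul_on_closedBall {Ω : Set E} (hΩo : IsOpen Ω)
    (hΩb : Bornology.IsBounded Ω) {u : E → ℝ} {p : ℝ} (h : IsSolution Ω u p) (hp : 1 ≤ p)
    (hsub : ((n : ℝ) - 2) / 2 * p < ((n : ℝ) - 2) / 2 + 2) {y₀ : E} {r : ℝ} (hr : 0 < r)
    (hext : ∀ x ∈ closure Ω, r ≤ ‖x - y₀‖)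
    (hrefl : ∀ y : E, ‖y - y₀‖ ≤ r / 1024 → ∀ x ∈ closure Ω, ∀ s : ℝ, 1 < s →
      s * ‖x - y‖ ^ 2 ≤ (r + r / 1024) ^ 2 → y + s • (x - y) ∈ Ω)
    {x : E} (hx : x ∈ Ω) (hmax : ∀ w ∈ Ω, u w ≤ u x) (hxy : ‖x - y₀‖ ≤ r + r / 4096)
    {x' : E} (hx' : x' ∈ closedBall (y₀ + (1 + 1 / 4096 : ℝ) • (x - y₀)) (r / 4096 ^ 2)) :
    x' ∈ Ω ∧ u x ≤ (1 + 1 / 4096 : ℝ) ^ (((n : ℝ) - 2) / 2) * u x' := by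
  set q := y₀ + (1 + 1 / 4096 : ℝ) • (x - y₀) with hq
  set y : E := y₀ - (4096 : ℝ) • (x' - q) with hy
  have hyy : ‖y - y₀‖ ≤ r / 4096 := by
    rw [mem_closedBall, dist_eq_norm] at hx'
    rw [hy, sub_sub_cancel_left, norm_neg, norm_smul, Real.norm_of_nonneg (by norm_num)]
    linarith
  have hx'y : y + (1 + 1 / 4096 : ℝ) • (x - y) = x' := by
    rw [hy, hq]
    module
  have hlow : ∀ w ∈ closure Ω, r - r / 4096 ≤ ‖w - y‖ := fun w hw => by
    have h1 : ‖w - y₀‖ ≤ ‖w - y‖ + ‖y - y₀‖ := by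
      rw [show w - y₀ = (w - y) + (y - y₀) by abel]
      exact norm_add_le _ _
    linarith [hext w hw]
  have hup : ‖x - y‖ ≤ r + r / 2048 := by
    have h1 : ‖x - y‖ ≤ ‖x - y₀‖ + ‖y - y₀‖ := by
      rw [show x - y = (x - y₀) - (y - y₀) by abel]
      exact norm_sub_le _ _
    linarith
  have hpos : 0 < ‖x - y‖ := by linarith [hlow x (subset_closure hx)]
  have hl : (1 + 1 / 4096 : ℝ) * ‖x - y‖ ^ 2 ≤ (r + r / 1024) ^ 2 := by
    have h1 : ‖x - y‖ ^ 2 ≤ (r + r / 2048) ^ 2 := pow_le_pow_left₀ (norm_nonneg _) hup 2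
    have h2 : 0 < r ^ 2 := by positivity
    nlinarith only [h1, h2]
  have hs : IsMovingSphereSetup Ω u p (u x) y ((r - r / 4096) ^ 2) ((r + r / 1024) ^ 2) :=
    { isOpen := hΩo
      isBounded := hΩb
      isSolution := h
      one_le := hp
      subcritical := hsub
      le_bound := hmax
      d_pos := pow_pos (by linarith) 2
      d_le := fun w hw => pow_le_pow_left₀ (by linarith) (hlow w hw) 2
      reflect_mem := hrefl y (by linarith) }
  have hsq : 0 < ‖x - y‖ ^ 2 := by positivity
  refine ⟨?_, ?_⟩
  · rw [← hx'y]
    exact hrefl y (by linarith) x (subset_closure hx) _ (by norm_num) hl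
  · have h1 := hs.le_kelvin hl hx (by linarith)
    rwa [kelvin, mul_div_cancel_right₀ _ hsq.ne', hx'y] at h1

/-- Upper bound for the maximum in the superlinear subcritical range, when it is attained near the
touching point of an exterior ball. -/
theorem IsSolution.max_rpow_le {Ω : Set E} (hn : 3 ≤ n) (hΩo : IsOpen Ω)
    (hΩb : Bornology.IsBounded Ω) {u : E → ℝ} {p : ℝ} (h : IsSolution Ω u p) (hp : 1 ≤ p)
    (hsub : ((n : ℝ) - 2) / 2 * p < ((n : ℝ) - 2) / 2 + 2) {y₀ : E} {r : ℝ} (hr : 0 < r)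
    (hext : ∀ x ∈ closure Ω, r ≤ ‖x - y₀‖)
    (hrefl : ∀ y : E, ‖y - y₀‖ ≤ r / 1024 → ∀ x ∈ closure Ω, ∀ s : ℝ, 1 < s →
      s * ‖x - y‖ ^ 2 ≤ (r + r / 1024) ^ 2 → y + s • (x - y) ∈ Ω)
    {x : E} (hx : x ∈ Ω) (hmax : ∀ w ∈ Ω, u w ≤ u x) (hxy : ‖x - y₀‖ ≤ r + r / 4096) :
    u x ^ (p - 1) ≤ 4 * n * (1 + 1 / 4096 : ℝ) ^ (((n : ℝ) - 2) / 2 + 2) /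
      (r / 4096 ^ 2) ^ 2 := by
  set M := u x with hM
  have hM0 : 0 < M := h.2.2.2.1 x hx
  have hn' : (3 : ℝ) ≤ n := by exact_mod_cast hn
  set μ : ℝ := ((n : ℝ) - 2) / 2 with hμ
  have hμ0 : 0 < μ := by rw [hμ]; linarith
  set A : ℝ := (1 + 1 / 4096 : ℝ) ^ μ with hA
  have hA0 : 0 < A := by positivity
  set R : ℝ := r / 4096 ^ 2 with hR
  have hR0 : 0 < R := by positivity
  set q := y₀ + (1 + 1 / 4096 : ℝ) • (x - y₀) with hq
  have key : ∀ w ∈ closedBall q R, w ∈ Ω ∧ M ≤ A * u w := fun w hw =>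
    h.max_le_mul_on_closedBall hΩo hΩb hp hsub hr hext hrefl hx hmax hxy hw
  have h1 : (M / A) ^ p * R ^ 2 / (4 * n) ≤ u q := by
    refine le_center_of_le_lap (by lia) hR0 (by positivity)
      (fun w hw => h.contDiffAt hΩo (key w hw).1) (fun w hw => (h.2.2.2.1 w (key w hw).1).le)
      fun w hw => ?_
    rw [h.2.2.1 w (key w hw).1]
    refine Real.rpow_le_rpow (by positivity) ?_ (by linarith)
    rw [div_le_iff₀ hA0, mul_comm]
    exact (key w hw).2
  have h2 := h1.trans (hmax q (key q (mem_closedBall_self hR0.le)).1)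
  rw [Real.div_rpow hM0.le hA0.le] at h2
  have h3 : A ^ p ≤ (1 + 1 / 4096 : ℝ) ^ (μ + 2) := by
    rw [hA, ← Real.rpow_mul (by norm_num)]
    exact Real.rpow_le_rpow_of_exponent_le (by norm_num) hsub.le
  have hAp : 0 < A ^ p := by positivity
  have h4 : M ^ (p - 1) ≤ 4 * n * A ^ p / R ^ 2 := by
    rw [Real.rpow_sub_one hM0.ne']
    rw [div_le_iff₀ hM0, div_mul_eq_mul_div, le_div_iff₀ (by positivity)]
    rw [div_le_iff₀ (by positivity), div_mul_eq_mul_div, div_le_iff₀ hAp] at h2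
    linarith
  refine h4.trans ?_
  gcongr

theorem IsSolution.one_le_rpow_mul_barrier {Ω : Set E} (hΩo : IsOpen Ω)
    (hΩb : Bornology.IsBounded Ω) {u β : E → ℝ} {p : ℝ} (h : IsSolution Ω u p) (hp : 0 ≤ p)
    (hβ : ContDiff ℝ 2 β) (hβ0 : ∀ x ∈ closure Ω, 0 ≤ β x) (hβl : ∀ x ∈ Ω, 1 < lap β x)
    {x : E} (hx : x ∈ Ω) (hmax : ∀ w ∈ Ω, u w ≤ u x) : 1 ≤ u x ^ (p - 1) * β x := by
  have hM0 : 0 < u x := h.2.2.2.1 x hx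
  have h1 := le_of_lap_le hΩo hΩb (c := u x ^ p) (by positivity)
    (fun w hw => h.contDiffAt hΩo hw) h.2.1 h.2.2.2.2 (fun w hw => ?_) hβ hβ0 hβl x hx
  · rw [Real.rpow_sub_one hM0.ne', div_mul_eq_mul_div, le_div_iff₀ hM0]
    linarith
  · rw [h.2.2.1 w hw]
    exact Real.rpow_le_rpow (h.2.2.2.1 w hw).le (hmax w hw) hp

theorem IsSolution.rpow_div_le_barrier {Ω : Set E} (hΩo : IsOpen Ω)
    (hΩb : Bornology.IsBounded Ω) {u β : E → ℝ} {p : ℝ} (h : IsSolution Ω u p) (hp : p ≤ 0)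
    (hβ : ContDiff ℝ 2 β) (hβ0 : ∀ x ∈ closure Ω, 0 ≤ β x) (hβl : ∀ x ∈ Ω, 1 < lap β x)
    {x : E} (hx : x ∈ Ω) : u x ^ (1 - p) / (1 - p) ≤ β x := by
  have ha : 0 < 1 - p := by linarith
  have hG : ∀ s : ℝ, 0 < s → HasDerivAt (fun s : ℝ => s ^ (1 - p) / (1 - p)) (s ^ (-p)) s := by
    intro s hs
    have h1 := (Real.hasDerivAt_rpow_const (p := 1 - p) (Or.inl hs.ne')).div_const (1 - p)
    rwa [mul_div_cancel_left₀ _ ha.ne', show 1 - p - 1 = -p by ring] at h1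
  have hGc : ∀ s : ℝ, 0 < s → ContDiffAt ℝ 2 (fun s : ℝ => s ^ (1 - p) / (1 - p)) s :=
    fun s hs => (Real.contDiffAt_rpow_const_of_ne hs.ne').div_const _
  have h1 := le_of_lap_le hΩo hΩb (w := fun z => u z ^ (1 - p) / (1 - p)) one_pos
    (fun w hw => (hGc _ (h.2.2.2.1 w hw)).comp w (h.contDiffAt hΩo hw))
    ((h.2.1.rpow_const fun _ _ => Or.inr ha.le).div_const _)
    (fun w hw => by simp [h.2.2.2.2 w hw, Real.zero_rpow ha.ne']) (fun w hw => ?_)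
    hβ hβ0 hβl x hx
  · linarith
  · have hw0 := h.2.2.2.1 w hw
    have hG' := Real.hasDerivAt_rpow_const (x := u w) (p := -p) (Or.inl hw0.ne')
    rw [lap_comp (h.contDiffAt hΩo hw) (hGc _ hw0)
      ((eventually_gt_nhds hw0).mono fun s hs => hG s hs) hG', h.2.2.1 w hw,
      ← Real.rpow_add hw0, neg_add_cancel, Real.rpow_zero]
    have h2 : 0 ≤ ∑ i : Fin n, (fderiv ℝ u w (EuclideanSpace.single i 1)) ^ 2 :=
      Finset.sum_nonneg fun i _ => sq_nonneg _
    have h3 : 0 ≤ -p * u w ^ (-p - 1) := mul_nonneg (by linarith) (by positivity)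
    linarith [mul_nonneg h3 h2]

/-- Maximum points of subcritical solutions stay away from any given boundary point. -/
theorem exists_pos_le_dist_of_mem_frontier {Ω : Set E} (hn : 3 ≤ n) (hΩo : IsOpen Ω)
    (hΩb : Bornology.IsBounded Ω) (hΩs : HasSmoothBoundary Ω) {z : E} (hz : z ∈ frontier Ω) :
    ∃ δ : ℝ, 0 < δ ∧ ∀ (p : ℝ) (u : E → ℝ),
      ((n : ℝ) - 2) / 2 * p < ((n : ℝ) - 2) / 2 + 2 → IsSolution Ω u p →
        ∀ x ∈ Ω, IsMaxOn u Ω x → δ ≤ dist x z := by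
  obtain ⟨y₀, r, hr, hzy, hext, hrefl⟩ := hΩs.exists_exterior_ball hΩo hz
  obtain ⟨β, hβ, hβ0, hβz, hβl⟩ := exists_barrier hΩb (by lia) hr hzy hext
  obtain ⟨q, hq⟩ : Ω.Nonempty := closure_nonempty_iff.1 ⟨z, hz.1⟩
  obtain ⟨R, hR, hRΩ⟩ := Metric.nhds_basis_closedBall.mem_iff.1 (hΩo.mem_nhds hq)
  set K₁ : ℝ := ((n : ℝ) + 2) ^ 2 / (2 * R ^ 2) with hK₁
  set K₂ : ℝ := 4 * n * (1 + 1 / 4096 : ℝ) ^ (((n : ℝ) - 2) / 2 + 2) / (r / 4096 ^ 2) ^ 2 with hK₂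
  set c : ℝ := R ^ 2 / (4 * n + 8) with hc
  have hK₁0 : 0 ≤ K₁ := by positivity
  have hK₂0 : 0 ≤ K₂ := by positivity
  have hc0 : 0 < c := by positivity
  set θ : ℝ := min c (1 / (K₁ + K₂ + 1)) with hθ
  have hθ0 : 0 < θ := lt_min hc0 (by positivity)
  have hev : ∀ᶠ x in 𝓝 z, β x < θ :=
    hβ.continuous.continuousAt.eventually_lt continuousAt_const (by rwa [hβz])
  obtain ⟨η, hη, hηβ⟩ := Metric.eventually_nhds_iff.1 hev
  refine ⟨min η (r / 4096), lt_min hη (by positivity), fun p u hsub h x hx hmax => ?_⟩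
  by_contra! hlt
  have hmax' : ∀ w ∈ Ω, u w ≤ u x := fun w hw => hmax hw
  have hβx : β x < θ := hηβ (hlt.trans_le (min_le_left _ _))
  have hxy : ‖x - y₀‖ ≤ r + r / 4096 := by
    have h1 : ‖x - z‖ < r / 4096 := by
      rw [← dist_eq_norm]
      exact hlt.trans_le (min_le_right _ _)
    have h2 : ‖x - y₀‖ ≤ ‖x - z‖ + ‖z - y₀‖ := by
      rw [show x - y₀ = (x - z) + (z - y₀) by abel]
      exact norm_add_le _ _
    linarith
  rcases lt_or_ge p 0 with hp | hp
  · have h1 := h.rpow_div_le_barrier hΩo hΩb hp.le hβ hβ0 hβl hx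
    have h2 := le_rpow_one_sub hR (by linarith : p < 1)
      (fun w hw => h.contDiffAt hΩo (hRΩ hw)) (fun w hw => h.2.2.2.1 w (hRΩ hw))
      (fun w hw => hmax' w (hRΩ hw)) fun w hw => h.2.2.1 w (hRΩ hw)
    have ha : 0 < 1 - p := by linarith
    have h3 : c ≤ u x ^ (1 - p) / (1 - p) := by
      rw [le_div_iff₀ ha]
      linarith
    linarith [min_le_left c (1 / (K₁ + K₂ + 1))]
  · have h1 : u x ^ (p - 1) ≤ K₁ + K₂ := by
      rcases le_total p 1 with hp1 | hp1
      · have := rpow_sub_one_le_of_le_one hR hp1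
          (fun w hw => h.contDiffAt hΩo (hRΩ hw)) (fun w hw => h.2.2.2.1 w (hRΩ hw))
          (fun w hw => hmax' w (hRΩ hw)) fun w hw => h.2.2.1 w (hRΩ hw)
        linarith
      · have := h.max_rpow_le hn hΩo hΩb hp1 hsub hr hext hrefl hx hmax' hxy
        linarith
    have h2 := h.one_le_rpow_mul_barrier hΩo hΩb hp hβ hβ0 hβl hx hmax'
    have h3 : β x < 1 / (K₁ + K₂ + 1) := hβx.trans_le (min_le_right _ _)
    rw [lt_div_iff₀ (by positivity)] at h3
    have h4 := hβ0 x (subset_closure hx)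
    have h5 : u x ^ (p - 1) * β x ≤ (K₁ + K₂) * β x := by gcongr
    linarith

/-- Maximum points of subcritical solutions stay uniformly away from the boundary. -/
theorem exists_pos_forall_le_dist {Ω : Set E} (hn : 3 ≤ n) (hΩo : IsOpen Ω)
    (hΩb : Bornology.IsBounded Ω) (hΩs : HasSmoothBoundary Ω) :
    ∃ δ : ℝ, 0 < δ ∧ ∀ (p : ℝ) (u : E → ℝ),
      ((n : ℝ) - 2) / 2 * p < ((n : ℝ) - 2) / 2 + 2 → IsSolution Ω u p →
        ∀ x ∈ Ω, IsMaxOn u Ω x → ∀ z ∈ frontier Ω, δ ≤ dist x z := by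
  have hcomp : IsCompact (frontier Ω) :=
    Metric.isCompact_of_isClosed_isBounded isClosed_frontier
      (hΩb.closure.subset frontier_subset_closure)
  refine hcomp.induction_on (p := fun s => ∃ δ : ℝ, 0 < δ ∧ ∀ (p : ℝ) (u : E → ℝ),
      ((n : ℝ) - 2) / 2 * p < ((n : ℝ) - 2) / 2 + 2 → IsSolution Ω u p →
        ∀ x ∈ Ω, IsMaxOn u Ω x → ∀ z ∈ s, δ ≤ dist x z) ?_ ?_ ?_ ?_
  · exact ⟨1, one_pos, by simp⟩
  · rintro s t hst ⟨δ, hδ, H⟩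
    exact ⟨δ, hδ, fun p u hp h x hx hm z hz => H p u hp h x hx hm z (hst hz)⟩
  · rintro s t ⟨δ, hδ, H⟩ ⟨δ', hδ', H'⟩
    refine ⟨min δ δ', lt_min hδ hδ', fun p u hp h x hx hm z hz => ?_⟩
    rcases hz with hz | hz
    · exact (min_le_left _ _).trans (H p u hp h x hx hm z hz)
    · exact (min_le_right _ _).trans (H' p u hp h x hx hm z hz)
  · intro z hz
    obtain ⟨δ, hδ, H⟩ := exists_pos_le_dist_of_mem_frontier hn hΩo hΩb hΩs hz
    refine ⟨ball z (δ / 2), mem_nhdsWithin_of_mem_nhds (ball_mem_nhds z (by positivity)),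
      δ / 2, by positivity, fun p u hp h x hx hm w hw => ?_⟩
    have h1 := H p u hp h x hx hm
    have h2 := dist_triangle x w z
    rw [mem_ball] at hw
    linarith

end MaximumPoints

/-- maximum points of solutions of `Δu = u^(N-1-ε)` with Dirichlet
condition stay at uniform distance `δ = δ(Ω, n) > 0` from the boundary. -/
theorem stmt_2 {n : ℕ} (hn : 3 ≤ n) (Ω : Set (EuclideanSpace ℝ (Fin n)))
    (hΩo : IsOpen Ω) (hΩb : Bornology.IsBounded Ω) (hΩs : HasSmoothBoundary Ω) :
    ∃ δ : ℝ, 0 < δ ∧ ∀ ε : ℝ, 0 < ε →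
      ∀ u : EuclideanSpace ℝ (Fin n) → ℝ,
        IsSolution Ω u (2 * (n : ℝ) / ((n : ℝ) - 2) - 1 - ε) →
        ∀ x ∈ Ω, IsMaxOn u Ω x → δ ≤ infDist x (frontier Ω) := by
  have hn' : (3 : ℝ) ≤ n := by exact_mod_cast hn
  obtain ⟨δ, hδ, H⟩ := exists_pos_forall_le_dist hn hΩo hΩb hΩs
  refine ⟨δ, hδ, fun ε hε u h x hx hmax => ?_⟩
  have hne : (frontier Ω).Nonempty := by
    have : Nonempty (Fin n) := ⟨⟨0, by lia⟩⟩
    refine nonempty_frontier_iff.2 ⟨⟨x, hx⟩, fun huniv => ?_⟩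
    exact NormedSpace.unbounded_univ ℝ (EuclideanSpace ℝ (Fin n)) (huniv ▸ hΩb)
  refine (le_infDist hne).2 fun z hz => H _ u ?_ h x hx hmax z hz
  have h2 : (n : ℝ) - 2 ≠ 0 := by linarith
  have h3 : ((n : ℝ) - 2) / 2 * (2 * n / (n - 2) - 1 - ε) =
      ((n : ℝ) - 2) / 2 + 2 - ((n : ℝ) - 2) / 2 * ε := by
    field_simp
    ring
  have h4 : 0 < ((n : ℝ) - 2) / 2 * ε := mul_pos (by linarith) hε
  linarith
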